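/- Let I be an alternating R-interval in ℝ/ℤ and let M ≥ 2 be an integer. Then: for subtype A1, 𝒩^+(I,M) = 𝒩^−(I,M) = {2/3^j : 1 ≤ j ≤ M+1} and 𝒩^+_o(I,M) = 𝒩^−_o(I,M) = {2/3^j : 2 ≤ j ≤ M}; for subtype A2, 𝒩^+(I,M) = 𝒩^−(I,M) = 𝒩^+_o(I,M) = 𝒩^−_o(I,M) = {1/3^j : 1 ≤ j ≤ M}; for type B, 𝒩^+(I,M) = {1/3^j : 1 ≤ j ≤ M}, 𝒩^+_o(I,M) = {1/3^j : 1 ≤ j ≤ M−1}, 𝒩^−(I,M) = {1/2} ∪ {1/3^j : 1 ≤ j ≤ M}, and 𝒩^−_o(I,M) = {1/3^j : 2 ≤ j ≤ M}; for type C, 𝒩^+(I,M) = {1/2} ∪ {1/3^j : 1 ≤ j ≤ M}, 𝒩^+_o(I,M) = {1/3^j : 2 ≤ j ≤ M}, 𝒩^−(I,M) = {1/3^j : 1 ≤ j ≤ M}, and 𝒩^−_o(I,M) = {1/3^j : 1 ≤ j ≤ M−1}. In particular, for every M ≥ 2 every alternating R-interval admits an admissible alternating decomposition into 2M+1 pieces.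 -/

import Mathlib

noncomputable section

open Set

/-- The circle `ℝ/ℤ`. -/
abbrev 𝕊 : Type := AddCircle (1 : ℝ)

/-- The natural projection from `ℝ` to the circle `ℝ/ℤ`. -/
def tc (x : ℝ) : 𝕊 := (x : 𝕊)

/-- The closed arc on the circle from `a` to `b`, traversed in the positive direction;
arcs are parametrized by real lifts `a ≤ b ≤ a + 1` of their endpoints. -/
def cArc (a b : ℝ) : Set 𝕊 := tc '' Set.Icc a b

/-- The open arc on the circle from `a` to `b` (the interior of `cArc a b`). -/
def oArc (a b : ℝ) : Set 𝕊 := tc '' Set.Ioo a b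

/-- The multiplication-by-`d` map `σ_d : ℝ/ℤ → ℝ/ℤ`, `σ_d t = d·t`. -/
def sigmaC (d : ℕ) (x : 𝕊) : 𝕊 := d • x

/-- The three model arcs `(0,1)` (type A), `(0,2/3)` (type B), `(1/3,1)` (type C) of
R-intervals, given by the pairs of endpoints. -/
def rTypes : Set (ℝ × ℝ) := {(0, 1), (0, 2/3), (1/3, 1)}

/-- The arc `[a,b]` is an R-interval of type `J` with blow-up exponent `n`: the map `σ₃^n`
restricts to a homeomorphism from the open arc `(a,b)` onto the open model arc `J`. -/
def RIntervalWith (a b : ℝ) (J : ℝ × ℝ) (n : ℕ) : Prop :=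
  a < b ∧ b ≤ a + 1 ∧ J ∈ rTypes ∧
    ∃ e : ↥(oArc a b) ≃ₜ ↥(oArc J.1 J.2),
      ∀ x : ↥(oArc a b), (e x : 𝕊) = (sigmaC 3)^[n] ↑x

/-- The arc `[a,b]` is an R-interval. -/
def IsRInterval (a b : ℝ) : Prop := ∃ J n, RIntervalWith a b J n

/-- A point of the circle is colored red if its reduced form is `p/3^k` with `k ≥ 1` and
`p ≡ 1 (mod 3)`. -/
def RedT (x : 𝕊) : Prop :=
  ∃ (p : ℤ) (k : ℕ), 1 ≤ k ∧ p % 3 = 1 ∧ x = tc ((p : ℝ) / 3 ^ k)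

/-- A point of the circle is colored blue if it is `0`, or if its reduced form is `p/3^k`
with `k ≥ 1` and `p ≡ 2 (mod 3)`. -/
def BlueT (x : 𝕊) : Prop :=
  x = 0 ∨ ∃ (p : ℤ) (k : ℕ), 1 ≤ k ∧ p % 3 = 2 ∧ x = tc ((p : ℝ) / 3 ^ k)

/-- `x` is the marked point of the R-interval `[a,b]`: the unique point of the open arc
`(a,b)` sent to `1/2` by the blow-up iterate of `σ₃`. -/
def IsMarkedPt (a b x : ℝ) : Prop :=
  x ∈ Set.Ioo a b ∧ ∃ J n, RIntervalWith a b J n ∧ (sigmaC 3)^[n] (tc x) = tc (1/2)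

/-- The arc `[a,b]` is an alternating R-interval: its two endpoints have different colors. -/
def IsAltRInterval (a b : ℝ) : Prop :=
  IsRInterval a b ∧ ((RedT (tc a) ∧ BlueT (tc b)) ∨ (BlueT (tc a) ∧ RedT (tc b)))

/-- `x 0 = a, …, x (2M+1) = b` parametrizes an alternating decomposition of `[a,b]` into
`2M+1` consecutive alternating R-intervals. -/
def AltDecomp (a b : ℝ) (M : ℕ) (x : ℕ → ℝ) : Prop :=
  x 0 = a ∧ x (2 * M + 1) = b ∧ ∀ i < 2 * M + 1, IsAltRInterval (x i) (x (i + 1))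

/-- The arcs `[a,b]` and `[c,d]` are R-intervals of the same type. -/
def SameRType (a b c d : ℝ) : Prop :=
  ∃ J, (∃ n, RIntervalWith a b J n) ∧ (∃ n, RIntervalWith c d J n)

/-- An alternating decomposition of `[a,b]` is admissible if some piece has the same type
as `[a,b]` and the same marked point. -/
def AdmissibleAltDecomp (a b : ℝ) (M : ℕ) (x : ℕ → ℝ) : Prop :=
  AltDecomp a b M x ∧
    ∃ i < 2 * M + 1, SameRType a b (x i) (x (i + 1)) ∧
      ∃ y : ℝ, IsMarkedPt a b y ∧ IsMarkedPt (x i) (x (i + 1)) y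

/-- `𝒩⁺(I, M)`: ratios `|J₁|/|I|` over alternating decompositions of `I` into `2M+1`
pieces. -/
def NPlus (a b : ℝ) (M : ℕ) : Set ℝ :=
  {r | ∃ x : ℕ → ℝ, AltDecomp a b M x ∧ r = (x 1 - x 0) / (b - a)}

/-- `𝒩⁻(I, M)`: ratios `|J_{2M+1}|/|I|` over alternating decompositions of `I` into `2M+1`
pieces. -/
def NMinus (a b : ℝ) (M : ℕ) : Set ℝ :=
  {r | ∃ x : ℕ → ℝ, AltDecomp a b M x ∧ r = (x (2 * M + 1) - x (2 * M)) / (b - a)}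

/-- `𝒩⁺ₒ(I, M)`: ratios `|J₁|/|I|` over admissible alternating decompositions. -/
def NPlusAdm (a b : ℝ) (M : ℕ) : Set ℝ :=
  {r | ∃ x : ℕ → ℝ, AdmissibleAltDecomp a b M x ∧ r = (x 1 - x 0) / (b - a)}

/-- `𝒩⁻ₒ(I, M)`: ratios `|J_{2M+1}|/|I|` over admissible alternating decompositions. -/
def NMinusAdm (a b : ℝ) (M : ℕ) : Set ℝ :=
  {r | ∃ x : ℕ → ℝ, AdmissibleAltDecomp a b M x ∧ r = (x (2 * M + 1) - x (2 * M)) / (b - a)}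

/-- `[u,v]` is the real model of an R-interval of type `J` and exponent `m`. -/
def IsTriadicPiece (J : ℝ × ℝ) (m : ℕ) (u v : ℝ) : Prop :=
  ∃ k : ℤ, u = (k + J.1) / 3 ^ m ∧ v = (k + J.2) / 3 ^ m

theorem tc_eq_tc_iff {x y : ℝ} : tc x = tc y ↔ ∃ z : ℤ, x = y + z := by
  rw [tc, tc, ← sub_eq_zero, ← AddCircle.coe_sub, AddCircle.coe_eq_zero_iff]
  refine exists_congr fun z => ?_
  rw [zsmul_one]
  constructor <;> intro h <;> linarith

theorem sigmaC_iterate (d n : ℕ) (x : 𝕊) : (sigmaC d)^[n] x = (d ^ n) • x := by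
  induction n with
  | zero => simp
  | succ n ih => rw [Function.iterate_succ_apply', ih, sigmaC, smul_smul, pow_succ']

theorem sigmaC_iterate_tc (n : ℕ) (x : ℝ) : (sigmaC 3)^[n] (tc x) = tc (3 ^ n * x) := by
  rw [sigmaC_iterate, tc, tc, ← AddCircle.coe_nsmul]
  simp

theorem tc_notMem_oArc_left {a b : ℝ} (h : b ≤ a + 1) : tc a ∉ oArc a b := by
  rintro ⟨t, ⟨h1, h2⟩, h3⟩
  obtain ⟨z, hz⟩ := tc_eq_tc_iff.1 h3
  have h4 : (0 : ℝ) < z := by linarith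
  have h5 : (z : ℝ) < 1 := by linarith
  norm_cast at h4 h5
  omega

theorem tc_notMem_oArc_right {a b : ℝ} (h : b ≤ a + 1) : tc b ∉ oArc a b := by
  rintro ⟨t, ⟨h1, h2⟩, h3⟩
  obtain ⟨z, hz⟩ := tc_eq_tc_iff.1 h3
  have h4 : (z : ℝ) < 0 := by linarith
  have h5 : (-1 : ℝ) < z := by linarith
  norm_cast at h4 h5
  omega

theorem oArc_add_int (a b : ℝ) (k : ℤ) : oArc (a + k) (b + k) = oArc a b := by
  ext x
  constructor
  · rintro ⟨t, ⟨h1, h2⟩, rfl⟩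
    exact ⟨t - k, ⟨by linarith, by linarith⟩, tc_eq_tc_iff.2 ⟨-k, by push_cast; ring⟩⟩
  · rintro ⟨t, ⟨h1, h2⟩, rfl⟩
    exact ⟨t + k, ⟨by linarith, by linarith⟩, tc_eq_tc_iff.2 ⟨k, rfl⟩⟩

theorem exists_int_of_oArc_eq {a b α β : ℝ} (hab : a < b) (hab' : b ≤ a + 1)
    (hβ : β ≤ α + 1) (h : oArc a b = oArc α β) : ∃ k : ℤ, a = α + k ∧ b = β + k := by
  have hm : tc ((a + b) / 2) ∈ oArc α β := h ▸ ⟨_, ⟨by linarith, by linarith⟩, rfl⟩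
  obtain ⟨c, ⟨hc1, hc2⟩, hc3⟩ := hm
  obtain ⟨z, hz⟩ := tc_eq_tc_iff.1 hc3
  have h' : oArc (a + z) (b + z) = oArc α β := by rw [oArc_add_int, h]
  refine ⟨-z, ?_, ?_⟩
  · push_cast
    rcases lt_trichotomy (a + z) α with h1 | h1 | h1
    · exact absurd (h' ▸ ⟨α, ⟨h1, by linarith⟩, rfl⟩) (tc_notMem_oArc_left hβ)
    · linarith
    · have hmem : tc (a + z) ∈ oArc α β := ⟨a + z, ⟨h1, by linarith⟩, rfl⟩
      exact absurd (h'.symm ▸ hmem) (tc_notMem_oArc_left (by linarith))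
  · push_cast
    rcases lt_trichotomy (b + z) β with h1 | h1 | h1
    · have hmem : tc (b + z) ∈ oArc α β := ⟨b + z, ⟨by linarith, h1⟩, rfl⟩
      exact absurd (h'.symm ▸ hmem) (tc_notMem_oArc_right (by linarith))
    · linarith
    · exact absurd (h' ▸ ⟨β, ⟨by linarith, h1⟩, rfl⟩) (tc_notMem_oArc_right hβ)

theorem rTypes_bounds {J : ℝ × ℝ} (hJ : J ∈ rTypes) :
    0 ≤ J.1 ∧ J.1 < 1 / 2 ∧ 1 / 2 < J.2 ∧ J.2 ≤ 1 ∧ 2 / 3 ≤ J.2 - J.1 := by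
  rcases hJ with rfl | rfl | rfl <;> norm_num

theorem isOpenMap_tc : IsOpenMap tc := QuotientAddGroup.isOpenMap_coe

theorem isOpenMap_sigmaC_iterate (n : ℕ) : IsOpenMap (sigmaC 3)^[n] := by
  intro U hU
  have hc : Continuous tc := AddCircle.continuous_mk' 1
  have : (sigmaC 3)^[n] '' U = tc '' ((fun x : ℝ => 3 ^ n * x) '' (tc ⁻¹' U)) := by
    ext x
    constructor
    · rintro ⟨y, hy, rfl⟩
      obtain ⟨t, rfl⟩ : ∃ t : ℝ, tc t = y := QuotientAddGroup.mk_surjective y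
      exact ⟨_, ⟨t, hy, rfl⟩, (sigmaC_iterate_tc n t).symm⟩
    · rintro ⟨_, ⟨t, ht, rfl⟩, rfl⟩
      exact ⟨tc t, ht, sigmaC_iterate_tc n t⟩
  rw [this]
  exact isOpenMap_tc _ ((Homeomorph.mulLeft₀ ((3 : ℝ) ^ n) (by positivity)).isOpenMap _ (hU.preimage hc))

theorem image_sigmaC_iterate_oArc (n : ℕ) (a b : ℝ) :
    (sigmaC 3)^[n] '' oArc a b = oArc (3 ^ n * a) (3 ^ n * b) := by
  have h3 : (0 : ℝ) < 3 ^ n := by positivity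
  ext x
  constructor
  · rintro ⟨_, ⟨t, ⟨h1, h2⟩, rfl⟩, rfl⟩
    exact ⟨3 ^ n * t, ⟨by gcongr, by gcongr⟩, (sigmaC_iterate_tc n t).symm⟩
  · rintro ⟨t, ⟨h1, h2⟩, rfl⟩
    refine ⟨_, ⟨t / 3 ^ n, ⟨by rw [lt_div_iff₀ h3]; linarith, by rw [div_lt_iff₀ h3]; linarith⟩,
      rfl⟩, ?_⟩
    rw [sigmaC_iterate_tc]
    congr 1
    field_simp

theorem RIntervalWith.isTriadicPiece {a b : ℝ} {J : ℝ × ℝ} {n : ℕ}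
    (h : RIntervalWith a b J n) : IsTriadicPiece J n a b := by
  obtain ⟨hab, hab', hJ, e, he⟩ := h
  obtain ⟨hJ1, hJ2, hJ3, hJ4, -⟩ := rTypes_bounds hJ
  have h3 : (0 : ℝ) < 3 ^ n := by positivity
  have himg : oArc (3 ^ n * a) (3 ^ n * b) = oArc J.1 J.2 := by
    rw [← image_sigmaC_iterate_oArc]
    ext x
    constructor
    · rintro ⟨y, hy, rfl⟩
      rw [← he ⟨y, hy⟩]
      exact (e ⟨y, hy⟩).2
    · intro hx
      refine ⟨e.symm ⟨x, hx⟩, (e.symm ⟨x, hx⟩).2, ?_⟩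
      rw [← he]
      simp
  have hlen : 3 ^ n * b ≤ 3 ^ n * a + 1 := by
    by_contra! hlt
    have hlt' : a + 1 / 3 ^ n < b := by
      have : 3 ^ n * (a + 1 / 3 ^ n) < 3 ^ n * b := by
        rw [mul_add, mul_one_div_cancel h3.ne']; exact hlt
      exact lt_of_mul_lt_mul_left this h3.le
    obtain ⟨t, ht1, ht2⟩ := exists_between hlt'
    have hp : (0 : ℝ) < 1 / 3 ^ n := by positivity
    have m1 : tc t ∈ oArc a b := ⟨t, ⟨by linarith, ht2⟩, rfl⟩
    have m2 : tc (t - 1 / 3 ^ n) ∈ oArc a b := ⟨_, ⟨by linarith, by linarith⟩, rfl⟩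
    have heq : e ⟨_, m1⟩ = e ⟨_, m2⟩ := by
      apply Subtype.ext
      rw [he, he]
      simp only [sigmaC_iterate_tc]
      exact tc_eq_tc_iff.2 ⟨1, by field_simp; push_cast; ring⟩
    have := congrArg Subtype.val (e.injective heq)
    obtain ⟨z, hz⟩ := tc_eq_tc_iff.1 this
    have hz0 : (0 : ℝ) < z := by linarith
    have hz1 : (z : ℝ) < 1 := by linarith
    norm_cast at hz0 hz1
    omega
  obtain ⟨k, hk1, hk2⟩ := exists_int_of_oArc_eq (by gcongr) hlen (by linarith) himg
  refine ⟨k, ?_, ?_⟩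
  · rw [eq_div_iff h3.ne']; linarith
  · rw [eq_div_iff h3.ne']; linarith

theorem IsTriadicPiece.rIntervalWith {a b : ℝ} {J : ℝ × ℝ} {n : ℕ} (hJ : J ∈ rTypes)
    (h : IsTriadicPiece J n a b) : RIntervalWith a b J n := by
  obtain ⟨k, rfl, rfl⟩ := h
  obtain ⟨hJ1, hJ2, hJ3, hJ4, -⟩ := rTypes_bounds hJ
  have h3 : (1 : ℝ) ≤ 3 ^ n := one_le_pow₀ (by norm_num)
  have h3' : (0 : ℝ) < 3 ^ n := by positivity
  have hlen : (k + J.2) / 3 ^ n ≤ (k + J.1) / 3 ^ n + 1 / 3 ^ n := by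
    rw [← add_div]; gcongr; linarith
  have hle1 : (1 : ℝ) / 3 ^ n ≤ 1 := by rw [div_le_one h3']; exact h3
  refine ⟨by gcongr; linarith, by linarith, hJ, ?_⟩
  set a := (k + J.1) / 3 ^ n with ha
  set b := (k + J.2) / 3 ^ n with hb
  let f : oArc a b → 𝕊 := fun x => (sigmaC 3)^[n] x
  have hopen : IsOpen (oArc a b) := isOpenMap_tc _ isOpen_Ioo
  have hcont : Continuous f := by
    have : f = fun x : oArc a b => (3 ^ n) • (x : 𝕊) := by
      funext x; exact sigmaC_iterate 3 n x
    rw [this]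
    fun_prop
  have hinj : Function.Injective f := by
    rintro ⟨_, t, ⟨ht1, ht2⟩, rfl⟩ ⟨_, t', ⟨ht1', ht2'⟩, rfl⟩ hf
    apply Subtype.ext
    simp only [f, sigmaC_iterate_tc] at hf
    obtain ⟨z, hz⟩ := tc_eq_tc_iff.1 hf
    have hz' : (z : ℝ) = 3 ^ n * (t - t') := by linarith
    have hmul : 3 ^ n * (1 / 3 ^ n : ℝ) = 1 := mul_one_div_cancel h3'.ne'
    have hz1 : (z : ℝ) < 1 := by
      rw [hz', ← hmul]; exact mul_lt_mul_of_pos_left (by linarith) h3'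
    have hz2 : (-1 : ℝ) < z := by
      have : 3 ^ n * (t' - t) < 1 := by
        rw [← hmul]; exact mul_lt_mul_of_pos_left (by linarith) h3'
      linarith
    norm_cast at hz1 hz2
    obtain rfl : z = 0 := by omega
    have : t = t' := by
      have : 3 ^ n * t = 3 ^ n * t' := by simpa using hz
      exact mul_left_cancel₀ h3'.ne' this
    simp [this]
  have hfo : IsOpenMap f := (isOpenMap_sigmaC_iterate n).comp hopen.isOpenMap_subtype_val
  have hemb : Topology.IsOpenEmbedding f :=
    Topology.IsOpenEmbedding.of_continuous_injective_isOpenMap hcont hinj hfo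
  have hrange : Set.range f = oArc J.1 J.2 := by
    have : Set.range f = (sigmaC 3)^[n] '' oArc a b := by
      rw [Set.image_eq_range]
    rw [this, image_sigmaC_iterate_oArc, ha, hb, mul_div_cancel₀ _ h3'.ne',
      mul_div_cancel₀ _ h3'.ne', add_comm, add_comm (k : ℝ), oArc_add_int]
  exact ⟨hemb.toIsEmbedding.toHomeomorph.trans (Homeomorph.setCongr hrange), fun x => rfl⟩

theorem rIntervalWith_iff {a b : ℝ} {J : ℝ × ℝ} {n : ℕ} :
    RIntervalWith a b J n ↔ J ∈ rTypes ∧ IsTriadicPiece J n a b :=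
  ⟨fun h => ⟨h.2.2.1, h.isTriadicPiece⟩, fun h => h.2.rIntervalWith h.1⟩

/-- `u` is a triadic rational whose reduced numerator is `1` (for even `t`) or `2` (for odd `t`)
modulo `3`. -/
def HasHue (t : ℕ) (u : ℝ) : Prop :=
  ∃ (p : ℤ) (k : ℕ), 1 ≤ k ∧ p % 3 = 1 + ((t % 2 : ℕ) : ℤ) ∧ u = p / 3 ^ k

theorem triadic_numerator_unique {p q : ℤ} {k l : ℕ} (hp : p % 3 ≠ 0) (hq : q % 3 ≠ 0)
    (h : (p : ℝ) / 3 ^ k = q / 3 ^ l) : p = q ∧ k = l := by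
  wlog hkl : k ≤ l generalizing p q k l
  · obtain ⟨h1, h2⟩ := this hq hp h.symm (by omega)
    exact ⟨h1.symm, h2.symm⟩
  obtain ⟨d, rfl⟩ := Nat.exists_eq_add_of_le hkl
  rw [div_eq_div_iff (by positivity) (by positivity), pow_add] at h
  have h' : (p : ℝ) * 3 ^ d = q := by
    have h3 : (3 : ℝ) ^ k ≠ 0 := by positivity
    apply mul_right_cancel₀ h3
    linarith
  have h'' : p * 3 ^ d = q := by exact_mod_cast h'
  rcases d with _ | d
  · simpa using h''
  · rw [pow_succ, ← mul_assoc] at h''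
    omega

theorem HasHue.residue_eq {t : ℕ} {p : ℤ} {k : ℕ} (h : HasHue t (p / 3 ^ k)) (hp : p % 3 ≠ 0) :
    p % 3 = 1 + ((t % 2 : ℕ) : ℤ) := by
  obtain ⟨q, l, -, hq, h⟩ := h
  rw [(triadic_numerator_unique hp (by omega) h).1]
  exact hq

theorem not_hasHue_int (t : ℕ) (z : ℤ) : ¬ HasHue t z := by
  rintro ⟨p, k, hk, hp, h⟩
  rw [eq_div_iff (by positivity)] at h
  have h' : z * 3 ^ k = p := by exact_mod_cast h
  obtain ⟨k, rfl⟩ := Nat.exists_eq_add_of_le' hk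
  rw [pow_succ, ← mul_assoc] at h'
  omega

theorem HasHue.congr {s t : ℕ} {u : ℝ} (h : HasHue s u) (hst : s % 2 = t % 2) : HasHue t u := by
  rwa [HasHue, ← hst]

theorem HasHue.mod_two_eq {s t : ℕ} {u : ℝ} (h : HasHue s u) (h' : HasHue t u) :
    s % 2 = t % 2 := by
  obtain ⟨p, k, -, hp, rfl⟩ := h
  have := h'.residue_eq (by omega)
  omega

theorem HasHue.add_int {t : ℕ} {u : ℝ} (h : HasHue t u) (z : ℤ) : HasHue t (u + z) := by
  obtain ⟨p, k, hk, hp, rfl⟩ := h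
  refine ⟨p + z * 3 ^ k, k, hk, ?_, by push_cast; field_simp⟩
  obtain ⟨k, rfl⟩ := Nat.exists_eq_add_of_le' hk
  rw [pow_succ, ← mul_assoc]
  omega

theorem HasHue.one_sub {t : ℕ} {u : ℝ} (h : HasHue t u) : HasHue (t + 1) (1 - u) := by
  obtain ⟨p, k, hk, hp, rfl⟩ := h
  refine ⟨3 ^ k - p, k, hk, ?_, by push_cast; field_simp⟩
  obtain ⟨k, rfl⟩ := Nat.exists_eq_add_of_le' hk
  rw [pow_succ]
  omega

theorem redT_tc_iff {x : ℝ} : RedT (tc x) ↔ HasHue 0 x := by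
  constructor
  · rintro ⟨p, k, hk, hp, h⟩
    obtain ⟨z, rfl⟩ := tc_eq_tc_iff.1 h
    exact HasHue.add_int ⟨p, k, hk, by simpa using hp, rfl⟩ z
  · rintro ⟨p, k, hk, hp, rfl⟩
    exact ⟨p, k, hk, by simpa using hp, rfl⟩

theorem blueT_tc_iff {x : ℝ} : BlueT (tc x) ↔ (∃ z : ℤ, x = z) ∨ HasHue 1 x := by
  constructor
  · rintro (h | ⟨p, k, hk, hp, h⟩)
    · have h0 : tc x = tc 0 := by rw [h]; rfl
      obtain ⟨z, hz⟩ := tc_eq_tc_iff.1 h0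
      exact Or.inl ⟨z, by simpa using hz⟩
    · obtain ⟨z, rfl⟩ := tc_eq_tc_iff.1 h
      exact Or.inr (HasHue.add_int ⟨p, k, hk, by simpa using hp, rfl⟩ z)
  · rintro (⟨z, rfl⟩ | ⟨p, k, hk, hp, rfl⟩)
    · left
      change tc z = tc 0
      exact tc_eq_tc_iff.2 ⟨z, by simp⟩
    · exact Or.inr ⟨p, k, hk, by simpa using hp, rfl⟩

theorem RedT.not_blueT {x : ℝ} (h : RedT (tc x)) : ¬ BlueT (tc x) := by
  rw [redT_tc_iff] at h
  rw [blueT_tc_iff]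
  rintro (⟨z, rfl⟩ | h')
  · exact not_hasHue_int 0 z h
  · simpa using h.mod_two_eq h'

/-- The point `x` of the circle is red (for even `t`) or blue (for odd `t`). -/
def CircleHue (t : ℕ) (x : ℝ) : Prop :=
  (t % 2 = 0 → RedT (tc x)) ∧ (t % 2 = 1 → BlueT (tc x))

theorem circleHue_even {t : ℕ} {x : ℝ} (ht : t % 2 = 0) : CircleHue t x ↔ RedT (tc x) := by
  simp [CircleHue, ht]

theorem circleHue_odd {t : ℕ} {x : ℝ} (ht : t % 2 = 1) : CircleHue t x ↔ BlueT (tc x) := by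
  simp [CircleHue, ht]

theorem isAltRInterval_iff {t : ℕ} {x y : ℝ} (hx : CircleHue t x) :
    IsAltRInterval x y ↔ IsRInterval x y ∧ CircleHue (t + 1) y := by
  refine and_congr_right fun _ => ?_
  rcases Nat.mod_two_eq_zero_or_one t with ht | ht
  · rw [circleHue_odd (by omega)]
    rw [circleHue_even ht] at hx
    simp [hx, hx.not_blueT]
  · rw [circleHue_even (by omega)]
    rw [circleHue_odd ht] at hx
    have : ¬ RedT (tc x) := fun h => h.not_blueT hx
    tauto

theorem exists_mul_pow_of_triadic_sub_int {p k : ℤ} {l n : ℕ} {u : ℝ} (h0 : 0 < u) (h1 : u < 1)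
    (h : (u + k) / 3 ^ n = (p : ℝ) / 3 ^ l) : n < l := by
  by_contra! hl
  obtain ⟨d, rfl⟩ := Nat.exists_eq_add_of_le hl
  rw [div_eq_div_iff (by positivity) (by positivity), pow_add] at h
  have h3 : (3 : ℝ) ^ l ≠ 0 := by positivity
  have h' : u + k = p * 3 ^ d := by
    apply mul_right_cancel₀ h3
    linarith
  have h2 : u = ((p * 3 ^ d - k : ℤ) : ℝ) := by push_cast; linarith
  rw [h2] at h0 h1
  norm_cast at h0 h1
  omega

theorem hasHue_rescale_iff {t n : ℕ} {k : ℤ} {u : ℝ} (h0 : 0 < u) (h1 : u < 1) :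
    HasHue t ((u + k) / 3 ^ n) ↔ HasHue t u := by
  constructor
  · rintro ⟨p, l, hl, hp, h⟩
    have hnl := exists_mul_pow_of_triadic_sub_int h0 h1 h
    obtain ⟨d, rfl⟩ := Nat.exists_eq_add_of_lt hnl
    have h' : u = p / 3 ^ (d + 1) + ((-k : ℤ) : ℝ) := by
      rw [div_eq_iff (by positivity)] at h
      push_cast
      rw [eq_add_neg_iff_add_eq, h]
      field_simp
      ring
    rw [h']
    exact HasHue.add_int ⟨p, d + 1, by omega, hp, rfl⟩ _
  · intro h
    obtain ⟨p, l, hl, hp, h⟩ := h.add_int k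
    exact ⟨p, l + n, by omega, hp, by rw [h, pow_add]; field_simp⟩

theorem circleHue_rescale_iff {t n : ℕ} {k : ℤ} {u : ℝ} (h0 : 0 < u) (h1 : u < 1) :
    CircleHue t ((u + k) / 3 ^ n) ↔ HasHue t u := by
  rcases Nat.mod_two_eq_zero_or_one t with ht | ht
  · rw [circleHue_even ht, redT_tc_iff, hasHue_rescale_iff h0 h1]
    exact ⟨fun h => h.congr (by omega), fun h => h.congr (by omega)⟩
  · rw [circleHue_odd ht, blueT_tc_iff, hasHue_rescale_iff h0 h1]
    constructor
    · rintro (⟨z, hz⟩ | h)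
      · have := exists_mul_pow_of_triadic_sub_int (p := z) (l := 0) h0 h1 (by simpa using hz)
        omega
      · exact h.congr (by omega)
    · exact fun h => Or.inr (h.congr (by omega))

/-- `[u,v]` is the real model of an R-interval. -/
def IsPiece (u v : ℝ) : Prop := ∃ J ∈ rTypes, ∃ m, IsTriadicPiece J m u v

theorem isRInterval_iff {u v : ℝ} : IsRInterval u v ↔ IsPiece u v := by
  simp only [IsRInterval, rIntervalWith_iff, IsPiece]
  exact ⟨fun ⟨J, n, h, h'⟩ => ⟨J, h, n, h'⟩, fun ⟨J, h, n, h'⟩ => ⟨J, n, h, h'⟩⟩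

theorem IsTriadicPiece.sub_eq {J : ℝ × ℝ} {m : ℕ} {u v : ℝ} (h : IsTriadicPiece J m u v) :
    v - u = (J.2 - J.1) / 3 ^ m := by
  obtain ⟨k, rfl, rfl⟩ := h
  ring

theorem IsPiece.lt {u v : ℝ} (h : IsPiece u v) : u < v := by
  obtain ⟨J, hJ, m, h⟩ := h
  have := (rTypes_bounds hJ).2.2.2.2
  have h' := h.sub_eq
  have : 0 < (J.2 - J.1) / 3 ^ m := div_pos (by linarith) (by positivity)
  linarith

theorem IsTriadicPiece.rescale {J : ℝ × ℝ} {m n : ℕ} {k : ℤ} {u v : ℝ}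
    (h : IsTriadicPiece J m u v) :
    IsTriadicPiece J (m + n) ((u + k) / 3 ^ n) ((v + k) / 3 ^ n) := by
  obtain ⟨l, rfl, rfl⟩ := h
  refine ⟨l + k * 3 ^ m, ?_, ?_⟩ <;> rw [pow_add] <;> push_cast <;> field_simp <;> ring

theorem IsTriadicPiece.of_rescale {J : ℝ × ℝ} (hJ : J ∈ rTypes) {m n : ℕ} {k : ℤ} {u v : ℝ}
    (huv : v - u ≤ 1) (h : IsTriadicPiece J m ((u + k) / 3 ^ n) ((v + k) / 3 ^ n)) :
    n ≤ m ∧ IsTriadicPiece J (m - n) u v := by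
  have hnm : n ≤ m := by
    by_contra! hlt
    obtain ⟨d, rfl⟩ := Nat.exists_eq_add_of_lt hlt
    have h1 := h.sub_eq
    have h2 : v - u = (J.2 - J.1) * (3 ^ d * 3) := by
      have h3 : (v + k) / 3 ^ (m + d + 1) - (u + k) / 3 ^ (m + d + 1)
        = (v - u) / 3 ^ (m + d + 1) := by ring
      rw [h3, div_eq_div_iff (by positivity) (by positivity), pow_succ, pow_add] at h1
      have h4 : (3 : ℝ) ^ m ≠ 0 := by positivity
      apply mul_right_cancel₀ h4
      linarith
    have h3 := (rTypes_bounds hJ).2.2.2.2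
    have h4 : (1 : ℝ) ≤ 3 ^ d := one_le_pow₀ (by norm_num)
    nlinarith
  obtain ⟨d, rfl⟩ := Nat.exists_eq_add_of_le hnm
  refine ⟨hnm, ?_⟩
  obtain ⟨l, h1, h2⟩ := h
  rw [div_eq_div_iff (by positivity) (by positivity), pow_add] at h1 h2
  have h4 : (3 : ℝ) ^ n ≠ 0 := by positivity
  refine ⟨l - k * 3 ^ d, ?_, ?_⟩
  · rw [Nat.add_sub_cancel_left, eq_div_iff (by positivity)]
    push_cast
    apply mul_right_cancel₀ h4
    linarith
  · rw [Nat.add_sub_cancel_left, eq_div_iff (by positivity)]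
    push_cast
    apply mul_right_cancel₀ h4
    linarith

theorem isPiece_rescale_iff {n : ℕ} {k : ℤ} {u v : ℝ} (huv : v - u ≤ 1) :
    IsPiece ((u + k) / 3 ^ n) ((v + k) / 3 ^ n) ↔ IsPiece u v :=
  ⟨fun ⟨J, hJ, _, h⟩ => ⟨J, hJ, _, (h.of_rescale hJ huv).2⟩,
    fun ⟨J, hJ, _, h⟩ => ⟨J, hJ, _, h.rescale⟩⟩

theorem pow_three_ne_two_mul (k l : ℕ) : (3 : ℝ) ^ k ≠ 2 * 3 ^ l := by
  intro h
  have h' : 3 ^ k = 2 * 3 ^ l := by exact_mod_cast h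
  have : Odd (3 ^ k) := Odd.pow (by decide)
  rw [h'] at this
  exact (Nat.not_odd_iff_even.2 (even_two_mul _)) this

theorem IsTriadicPiece.unique {J J' : ℝ × ℝ} (hJ : J ∈ rTypes) (hJ' : J' ∈ rTypes) {m m' : ℕ}
    {u v : ℝ} (h : IsTriadicPiece J m u v) (h' : IsTriadicPiece J' m' u v) :
    J = J' ∧ m = m' := by
  have h1 := h.sub_eq.symm.trans h'.sub_eq
  rw [div_eq_div_iff (by positivity) (by positivity)] at h1
  have key : J.2 - J.1 = J'.2 - J'.1 → m = m' := by
    intro h2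
    rw [h2] at h1
    have h3 := (rTypes_bounds hJ').2.2.2.2
    have h4 := mul_left_cancel₀ (by linarith : J'.2 - J'.1 ≠ 0) h1
    exact (pow_right_injective₀ (by norm_num : (0 : ℝ) < 3) (by norm_num) h4).symm
  have bc : ∀ {m : ℕ}, IsTriadicPiece (0, 2 / 3) m u v → ¬ IsTriadicPiece (1 / 3, 1) m u v := by
    rintro m ⟨k, hk, -⟩ ⟨l, hl, -⟩
    rw [hk, div_left_inj' (by positivity)] at hl
    have : 3 * (k : ℝ) = 3 * l + 1 := by linarith
    norm_cast at this
    omega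
  rcases hJ with rfl | rfl | rfl <;> rcases hJ' with rfl | rfl | rfl
  · exact ⟨rfl, key (by norm_num)⟩
  · exact absurd (by rw [pow_succ]; linarith) (pow_three_ne_two_mul (m' + 1) m)
  · exact absurd (by rw [pow_succ]; linarith) (pow_three_ne_two_mul (m' + 1) m)
  · exact absurd (by rw [pow_succ]; linarith) (pow_three_ne_two_mul (m + 1) m')
  · exact ⟨rfl, key (by norm_num)⟩
  · obtain rfl := key (by norm_num)
    exact absurd h' (bc h)
  · exact absurd (by rw [pow_succ]; linarith) (pow_three_ne_two_mul (m + 1) m')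
  · obtain rfl := key (by norm_num)
    exact absurd h (bc h')
  · exact ⟨rfl, key (by norm_num)⟩

theorem isMarkedPt_iff {J : ℝ × ℝ} (hJ : J ∈ rTypes) {n : ℕ} {k : ℤ} {a b y : ℝ}
    (ha : a = (k + J.1) / 3 ^ n) (hb : b = (k + J.2) / 3 ^ n) :
    IsMarkedPt a b y ↔ y = (k + 1 / 2) / 3 ^ n := by
  obtain ⟨hJ1, hJ2, hJ3, hJ4, -⟩ := rTypes_bounds hJ
  have h3 : (0 : ℝ) < 3 ^ n := by positivity
  have hab : IsTriadicPiece J n a b := ⟨k, ha, hb⟩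
  constructor
  · rintro ⟨⟨hy1, hy2⟩, J', n', h, hy⟩
    rw [rIntervalWith_iff] at h
    obtain ⟨rfl, rfl⟩ := hab.unique hJ h.1 h.2
    rw [sigmaC_iterate_tc] at hy
    obtain ⟨z, hz⟩ := tc_eq_tc_iff.1 hy
    rw [ha, div_lt_iff₀ h3] at hy1
    rw [hb, lt_div_iff₀ h3] at hy2
    have hz1 : (k : ℝ) < z + 1 := by linarith
    have hz2 : (z : ℝ) < k + 1 := by linarith
    norm_cast at hz1 hz2
    obtain rfl : z = k := by omega
    rw [eq_div_iff h3.ne']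
    linarith
  · rintro rfl
    refine ⟨⟨by rw [ha]; gcongr, by rw [hb]; gcongr⟩, J, n, rIntervalWith_iff.2 ⟨hJ, hab⟩, ?_⟩
    rw [sigmaC_iterate_tc]
    exact tc_eq_tc_iff.2 ⟨k, by field_simp; ring⟩

/-- `u 0 < … < u n` cuts out consecutive R-intervals, the interior points having alternating
hues, with hue `s + i` at `u i`. -/
def IsHueChain (s n : ℕ) (u : ℕ → ℝ) : Prop :=
  (∀ i < n, IsPiece (u i) (u (i + 1))) ∧ ∀ i, 0 < i → i < n → HasHue (s + i) (u i)

/-- An alternating decomposition of the model interval `J`, whose left endpoint carries the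
hue `s`. -/
def ModelDecomp (s : ℕ) (J : ℝ × ℝ) (M : ℕ) (u : ℕ → ℝ) : Prop :=
  u 0 = J.1 ∧ u (2 * M + 1) = J.2 ∧ IsHueChain s (2 * M + 1) u

/-- Some interval of the subdivision `u` is the image of the model interval `J` under the
contraction by `3 ^ m` about `1/2`. -/
def ModelCentered (J : ℝ × ℝ) (M : ℕ) (u : ℕ → ℝ) : Prop :=
  ∃ i < 2 * M + 1, ∃ m : ℕ, u i = 1 / 2 - (1 / 2 - J.1) / 3 ^ m ∧
    u (i + 1) = 1 / 2 + (J.2 - 1 / 2) / 3 ^ m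

theorem IsHueChain.lt {s n : ℕ} {u : ℕ → ℝ} (h : IsHueChain s n u) {i j : ℕ} (hij : i < j)
    (hj : j ≤ n) : u i < u j := by
  induction j with
  | zero => omega
  | succ j ih =>
    have h1 := (h.1 j (by omega)).lt
    rcases Nat.lt_succ_iff_lt_or_eq.1 hij with h2 | rfl
    · exact (ih h2 (by omega)).trans h1
    · exact h1

theorem IsHueChain.le {s n : ℕ} {u : ℕ → ℝ} (h : IsHueChain s n u) {i j : ℕ} (hij : i ≤ j)
    (hj : j ≤ n) : u i ≤ u j := by
  rcases hij.eq_or_lt with rfl | h1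
  · exact le_rfl
  · exact (h.lt h1 hj).le

theorem IsHueChain.lt_of_lt {s n : ℕ} {u : ℕ → ℝ} (h : IsHueChain s n u) {i j : ℕ} (hi : i ≤ n)
    (hlt : u i < u j) : i < j := by
  by_contra! hle
  exact absurd (h.le hle hi) (not_le.2 hlt)

theorem altDecomp_iff {s n M : ℕ} {k : ℤ} {J : ℝ × ℝ} (hJ : J ∈ rTypes)
    (hsa : CircleHue s ((k + J.1) / 3 ^ n)) (hsb : CircleHue (s + 1) ((k + J.2) / 3 ^ n))
    {u : ℕ → ℝ} :
    AltDecomp ((k + J.1) / 3 ^ n) ((k + J.2) / 3 ^ n) M (fun i => (u i + k) / 3 ^ n) ↔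
      ModelDecomp s J M u := by
  obtain ⟨hJ1, hJ2, hJ3, hJ4, -⟩ := rTypes_bounds hJ
  have h3 : (0 : ℝ) < 3 ^ n := by positivity
  have hend : ∀ x c : ℝ, (x + k) / 3 ^ n = (k + c) / 3 ^ n ↔ x = c := fun x c => by
    rw [div_left_inj' h3.ne', add_comm (k : ℝ), add_left_inj]
  unfold AltDecomp ModelDecomp
  rw [hend, hend]
  refine and_congr_right fun h0 => and_congr_right fun hM => ?_
  constructor
  · intro h
    have hlt : ∀ i < 2 * M + 1, u i < u (i + 1) := fun i hi => by
      have := (isRInterval_iff.1 (h i hi).1).lt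
      rw [div_lt_div_iff_of_pos_right h3] at this
      linarith
    have hmono : ∀ j, j ≤ 2 * M + 1 → ∀ i < j, u i < u j := by
      intro j
      induction j with
      | zero => omega
      | succ j ih =>
        intro hj i hi
        rcases Nat.lt_succ_iff_lt_or_eq.1 hi with h2 | rfl
        · exact (ih (by omega) i h2).trans (hlt j (by omega))
        · exact hlt i (by omega)
    have hhue : ∀ i, i ≤ 2 * M + 1 → CircleHue (s + i) ((u i + k) / 3 ^ n) := by
      intro i
      induction i with
      | zero => intro _; rw [(hend _ _).2 h0]; exact hsa
      | succ i ih => exact fun hi => ((isAltRInterval_iff (ih (by omega))).1 (h i (by omega))).2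
    have hbd : ∀ i, i ≤ 2 * M + 1 → J.1 ≤ u i ∧ u i ≤ J.2 := by
      intro i hi
      constructor
      · rcases Nat.eq_zero_or_pos i with rfl | h2
        · exact h0.ge
        · exact h0.symm.trans_le (hmono i hi 0 h2).le
      · rcases hi.eq_or_lt with rfl | h2
        · exact hM.le
        · exact (hmono _ le_rfl i h2).le.trans_eq hM
    refine ⟨fun i hi => ?_, fun i h1 h2 => ?_⟩
    · rw [← isPiece_rescale_iff (n := n) (k := k)]
      · exact isRInterval_iff.1 (h i hi).1
      · linarith [hbd i hi.le, hbd (i + 1) hi]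
    · rw [← circleHue_rescale_iff (n := n) (k := k)]
      · exact hhue i h2.le
      · linarith [hmono i h2.le 0 h1]
      · linarith [hmono _ le_rfl i h2]
  · intro h i hi
    have hbd : ∀ i, i ≤ 2 * M + 1 → J.1 ≤ u i ∧ u i ≤ J.2 := fun i hi =>
      ⟨h0.symm.trans_le (h.le (Nat.zero_le i) hi), (h.le hi le_rfl).trans_eq hM⟩
    have hhue : ∀ i, i ≤ 2 * M + 1 → CircleHue (s + i) ((u i + k) / 3 ^ n) := by
      intro i hi
      rcases Nat.eq_zero_or_pos i with rfl | h1
      · rw [(hend _ _).2 h0]; exact hsa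
      rcases hi.eq_or_lt with rfl | h2
      · rw [(hend _ _).2 hM]
        have : (s + (2 * M + 1)) % 2 = (s + 1) % 2 := by omega
        rwa [CircleHue, this]
      · rw [circleHue_rescale_iff]
        · exact h.2 i h1 h2
        · linarith [h.lt h1 h2.le]
        · linarith [h.lt h2 le_rfl]
    refine (isAltRInterval_iff (hhue i hi.le)).2 ⟨?_, hhue (i + 1) hi⟩
    rw [isRInterval_iff, isPiece_rescale_iff]
    · exact h.1 i hi
    · linarith [hbd i hi.le, hbd (i + 1) hi]

theorem admissibleAltDecomp_iff {s n M : ℕ} {k : ℤ} {J : ℝ × ℝ} (hJ : J ∈ rTypes)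
    (hsa : CircleHue s ((k + J.1) / 3 ^ n)) (hsb : CircleHue (s + 1) ((k + J.2) / 3 ^ n))
    {u : ℕ → ℝ} :
    AdmissibleAltDecomp ((k + J.1) / 3 ^ n) ((k + J.2) / 3 ^ n) M
      (fun i => (u i + k) / 3 ^ n) ↔ ModelDecomp s J M u ∧ ModelCentered J M u := by
  obtain ⟨hJ1, hJ2, hJ3, hJ4, -⟩ := rTypes_bounds hJ
  have hI : IsTriadicPiece J n ((k + J.1) / 3 ^ n) ((k + J.2) / 3 ^ n) := ⟨k, rfl, rfl⟩
  unfold AdmissibleAltDecomp ModelCentered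
  rw [altDecomp_iff hJ hsa hsb]
  refine and_congr_right fun ⟨h0, hM, h⟩ => exists_congr fun i => and_congr_right fun hi => ?_
  have hbd : u (i + 1) - u i ≤ 1 := by
    linarith [h.le (Nat.zero_le i) hi.le, h.le (Nat.succ_le_of_lt hi) le_rfl]
  constructor
  · rintro ⟨⟨J', ⟨n₁, h₁⟩, ⟨n₂, h₂⟩⟩, y, hy₁, hy₂⟩
    rw [rIntervalWith_iff] at h₁ h₂
    obtain ⟨rfl, rfl⟩ := hI.unique hJ h₁.1 h₁.2
    obtain ⟨hn, -⟩ := h₂.2.of_rescale hJ hbd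
    obtain ⟨d, rfl⟩ := Nat.exists_eq_add_of_le hn
    obtain ⟨l, hl₁, hl₂⟩ := h₂.2
    rw [isMarkedPt_iff hJ rfl rfl] at hy₁
    rw [isMarkedPt_iff hJ hl₁ hl₂, hy₁] at hy₂
    refine ⟨d, ?_, ?_⟩
    · rw [pow_add] at hl₁ hy₂
      field_simp at hl₁ hy₂ ⊢
      linarith
    · rw [pow_add] at hl₂ hy₂
      field_simp at hl₂ hy₂ ⊢
      linarith
  · rintro ⟨m, h₁, h₂⟩
    obtain ⟨c, hc⟩ : Odd ((3 : ℤ) ^ m) := Odd.pow (by decide)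
    have hc' : (3 : ℝ) ^ m = 2 * c + 1 := by exact_mod_cast hc
    have e₁ : (u i + k) / 3 ^ n = ((3 ^ m * k + c : ℤ) + J.1) / 3 ^ (n + m) := by
      rw [h₁, pow_add]
      push_cast
      field_simp
      linarith
    have e₂ : (u (i + 1) + k) / 3 ^ n = ((3 ^ m * k + c : ℤ) + J.2) / 3 ^ (n + m) := by
      rw [h₂, pow_add]
      push_cast
      field_simp
      linarith
    refine ⟨⟨J, ⟨n, rIntervalWith_iff.2 ⟨hJ, hI⟩⟩,
      ⟨n + m, rIntervalWith_iff.2 ⟨hJ, _, e₁, e₂⟩⟩⟩, _, (isMarkedPt_iff hJ rfl rfl).2 rfl, ?_⟩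
    refine (isMarkedPt_iff hJ e₁ e₂).2 ?_
    rw [pow_add]
    push_cast
    field_simp
    linarith

/-- The ratios of the first piece over alternating decompositions of a model interval. -/
def modelPlus (s : ℕ) (J : ℝ × ℝ) (M : ℕ) : Set ℝ :=
  {r | ∃ u, ModelDecomp s J M u ∧ r = (u 1 - u 0) / (J.2 - J.1)}

/-- The ratios of the first piece over admissible decompositions of a model interval. -/
def modelPlusAdm (s : ℕ) (J : ℝ × ℝ) (M : ℕ) : Set ℝ :=
  {r | ∃ u, (ModelDecomp s J M u ∧ ModelCentered J M u) ∧ r = (u 1 - u 0) / (J.2 - J.1)}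

/-- The reflection of the model interval `J` in the point `1/2`. -/
def reflType (J : ℝ × ℝ) : ℝ × ℝ := (1 - J.2, 1 - J.1)

theorem reflType_reflType (J : ℝ × ℝ) : reflType (reflType J) = J := by
  simp [reflType]

theorem reflType_mem {J : ℝ × ℝ} (hJ : J ∈ rTypes) : reflType J ∈ rTypes := by
  rcases hJ with rfl | rfl | rfl <;> norm_num [reflType, rTypes]

theorem IsPiece.refl {u v : ℝ} (h : IsPiece u v) : IsPiece (1 - v) (1 - u) := by
  obtain ⟨J, hJ, m, k, rfl, rfl⟩ := h
  refine ⟨reflType J, reflType_mem hJ, m, 3 ^ m - 1 - k, ?_, ?_⟩ <;>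
    simp only [reflType] <;> push_cast <;> field_simp <;> ring

theorem ModelDecomp.refl {s M : ℕ} {J : ℝ × ℝ} {u : ℕ → ℝ} (h : ModelDecomp s J M u) :
    ModelDecomp s (reflType J) M (fun i => 1 - u (2 * M + 1 - i)) := by
  obtain ⟨h0, hM, h1, h2⟩ := h
  refine ⟨by simp [hM, reflType], by simp [h0, reflType], fun i hi => ?_, fun i hi hi' => ?_⟩
  · have h := (h1 (2 * M + 1 - (i + 1)) (by omega)).refl
    rwa [show 2 * M + 1 - (i + 1) + 1 = 2 * M + 1 - i by omega] at h
  · exact (h2 (2 * M + 1 - i) (by omega) (by omega)).one_sub.congr (by omega)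

theorem ModelCentered.refl {M : ℕ} {J : ℝ × ℝ} {u : ℕ → ℝ} (h : ModelCentered J M u) :
    ModelCentered (reflType J) M (fun i => 1 - u (2 * M + 1 - i)) := by
  obtain ⟨i, hi, m, h1, h2⟩ := h
  refine ⟨2 * M - i, by omega, m, ?_, ?_⟩ <;> simp only [reflType]
  · rw [show 2 * M + 1 - (2 * M - i) = i + 1 by omega, h2]
    ring
  · rw [show 2 * M + 1 - (2 * M - i + 1) = i by omega, h1]
    ring

section Transfer

variable {s n M : ℕ} {k : ℤ} {J : ℝ × ℝ} {a b : ℝ}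

theorem exists_rescale (k : ℤ) (n : ℕ) (x : ℕ → ℝ) :
    ∃ u : ℕ → ℝ, x = fun i => (u i + k) / 3 ^ n :=
  ⟨fun i => 3 ^ n * x i - k, by funext i; field_simp; ring⟩

theorem rescale_ratio (x y : ℝ) :
    ((x + k) / 3 ^ n - (y + k) / 3 ^ n) / ((k + J.2) / 3 ^ n - (k + J.1) / 3 ^ n) =
      (x - y) / (J.2 - J.1) := by
  rw [← sub_div, ← sub_div, div_div_div_cancel_right₀ (by positivity)]
  ring

theorem nPlus_eq_modelPlus (hJ : J ∈ rTypes) (hI : IsTriadicPiece J n a b)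
    (hsa : CircleHue s a) (hsb : CircleHue (s + 1) b) : NPlus a b M = modelPlus s J M := by
  obtain ⟨k, rfl, rfl⟩ := hI
  ext r
  constructor
  · rintro ⟨x, hx, rfl⟩
    obtain ⟨u, rfl⟩ := exists_rescale k n x
    exact ⟨u, (altDecomp_iff hJ hsa hsb).1 hx, rescale_ratio _ _⟩
  · rintro ⟨u, hu, rfl⟩
    exact ⟨_, (altDecomp_iff hJ hsa hsb).2 hu, (rescale_ratio _ _).symm⟩

theorem nPlusAdm_eq_modelPlusAdm (hJ : J ∈ rTypes) (hI : IsTriadicPiece J n a b)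
    (hsa : CircleHue s a) (hsb : CircleHue (s + 1) b) :
    NPlusAdm a b M = modelPlusAdm s J M := by
  obtain ⟨k, rfl, rfl⟩ := hI
  ext r
  constructor
  · rintro ⟨x, hx, rfl⟩
    obtain ⟨u, rfl⟩ := exists_rescale k n x
    exact ⟨u, (admissibleAltDecomp_iff hJ hsa hsb).1 hx, rescale_ratio _ _⟩
  · rintro ⟨u, hu, rfl⟩
    exact ⟨_, (admissibleAltDecomp_iff hJ hsa hsb).2 hu, (rescale_ratio _ _).symm⟩

theorem refl_ratio (x y : ℝ) :
    (x - y) / (J.2 - J.1) = ((1 - y) - (1 - x)) / ((reflType J).2 - (reflType J).1) := by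
  simp only [reflType]
  congr 1 <;> ring

theorem nMinus_eq_modelPlus (hJ : J ∈ rTypes) (hI : IsTriadicPiece J n a b)
    (hsa : CircleHue s a) (hsb : CircleHue (s + 1) b) :
    NMinus a b M = modelPlus s (reflType J) M := by
  obtain ⟨k, rfl, rfl⟩ := hI
  ext r
  constructor
  · rintro ⟨x, hx, rfl⟩
    obtain ⟨u, rfl⟩ := exists_rescale k n x
    refine ⟨_, ((altDecomp_iff hJ hsa hsb).1 hx).refl, ?_⟩
    rw [rescale_ratio, refl_ratio]
    simp
  · rintro ⟨u, hu, rfl⟩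
    refine ⟨_, (altDecomp_iff hJ hsa hsb).2 (reflType_reflType J ▸ hu.refl), ?_⟩
    rw [rescale_ratio, refl_ratio]
    simp [reflType_reflType]

theorem nMinusAdm_eq_modelPlusAdm (hJ : J ∈ rTypes) (hI : IsTriadicPiece J n a b)
    (hsa : CircleHue s a) (hsb : CircleHue (s + 1) b) :
    NMinusAdm a b M = modelPlusAdm s (reflType J) M := by
  obtain ⟨k, rfl, rfl⟩ := hI
  ext r
  constructor
  · rintro ⟨x, hx, rfl⟩
    obtain ⟨u, rfl⟩ := exists_rescale k n x
    have h := (admissibleAltDecomp_iff hJ hsa hsb).1 hx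
    refine ⟨_, ⟨h.1.refl, h.2.refl⟩, ?_⟩
    rw [rescale_ratio, refl_ratio]
    simp
  · rintro ⟨u, ⟨hu, hu'⟩, rfl⟩
    refine ⟨_, (admissibleAltDecomp_iff hJ hsa hsb).2
      ⟨reflType_reflType J ▸ hu.refl, reflType_reflType J ▸ hu'.refl⟩, ?_⟩
    rw [rescale_ratio, refl_ratio]
    simp [reflType_reflType]

end Transfer

theorem IsPiece.left_of_crossing {v w : ℝ} (h : IsPiece v w) {q : ℤ} {l : ℕ}
    (hv : v < q / 3 ^ l) (hw : (q : ℝ) / 3 ^ l < w) : ∃ q' : ℤ, v = q' / 3 ^ l := by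
  obtain ⟨J, hJ, m, k, rfl, rfl⟩ := h
  obtain ⟨hJ1, hJ2, hJ3, hJ4, -⟩ := rTypes_bounds hJ
  rcases le_or_gt l m with hlm | hlm
  · obtain ⟨d, rfl⟩ := Nat.exists_eq_add_of_le hlm
    have hq : (q : ℝ) / 3 ^ l = q * 3 ^ d / 3 ^ (l + d) := by rw [pow_add]; field_simp
    rw [hq, div_lt_div_iff_of_pos_right (by positivity)] at hv hw
    have h1 : (k : ℝ) < q * 3 ^ d := by linarith
    have h2 : (q * 3 ^ d : ℝ) < k + 1 := by linarith
    norm_cast at h1 h2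
    omega
  · obtain ⟨d, rfl⟩ := Nat.exists_eq_add_of_lt hlm
    rcases hJ with rfl | rfl | rfl
    · exact ⟨3 ^ (d + 1) * k, by push_cast; field_simp; ring⟩
    · exact ⟨3 ^ (d + 1) * k, by push_cast; field_simp; ring⟩
    · exact ⟨3 ^ d * (3 * k + 1), by push_cast; field_simp; ring⟩

theorem HasHue.residue_eq_of_eq {t : ℕ} {u : ℝ} (h : HasHue t u) (p : ℤ) (k : ℕ)
    (hu : u = p / 3 ^ k) (hp : p % 3 ≠ 0) : p % 3 = 1 + ((t % 2 : ℕ) : ℤ) :=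
  HasHue.residue_eq (hu ▸ h) hp

/-- A chain cannot jump over `q / 3 ^ l` once it is within distance `3 ^ (-l)` of it. -/
theorem IsHueChain.reach {s n : ℕ} {u : ℕ → ℝ} (h : IsHueChain s n u) {i₀ l : ℕ} {q : ℤ}
    (hi₀ : i₀ ≤ n) (h1 : (q - 1 : ℝ) / 3 ^ l < u i₀) (h2 : u i₀ < q / 3 ^ l)
    (h3 : (q : ℝ) / 3 ^ l ≤ u n) : ∃ i, i₀ < i ∧ i ≤ n ∧ u i = q / 3 ^ l := by
  by_contra! hne
  have key : ∀ i, i₀ ≤ i → i ≤ n → u i < q / 3 ^ l := by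
    intro i hi
    induction i, hi using Nat.le_induction with
    | base => exact fun _ => h2
    | succ i hi ih =>
      intro hin
      have hlt := ih (by omega)
      rcases lt_trichotomy (u (i + 1)) (q / 3 ^ l) with h4 | h4 | h4
      · exact h4
      · exact absurd h4 (hne (i + 1) (by omega) hin)
      · obtain ⟨q', hq'⟩ := (h.1 i (by omega)).left_of_crossing hlt h4
        have h5 := h1.trans_le (h.le hi (by omega))
        rw [hq', div_lt_div_iff_of_pos_right (by positivity)] at h5 hlt
        have h6 : (q : ℝ) < q' + 1 := by linarith
        norm_cast at h6 hlt
        omega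
  exact absurd (key n hi₀ le_rfl) (not_lt.2 h3)

theorem IsHueChain.climb {s n : ℕ} {u : ℕ → ℝ} (h : IsHueChain s n u) {E : ℤ} {c : ℕ}
    (hn : (E : ℝ) / 3 ^ c + 1 / 3 ^ (c + 1) < u n) (d : ℕ) : ∀ {q₀ : ℕ}, q₀ ≤ n →
    (s + q₀) % 2 = 0 → u q₀ = E / 3 ^ c + 1 / 3 ^ (c + 1 + d) →
    ∃ l, q₀ + 2 * d ≤ l ∧ l < n ∧ (s + l) % 2 = 0 ∧ u l = E / 3 ^ c + 1 / 3 ^ (c + 1) := by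
  induction d with
  | zero =>
    intro q₀ hq hs hu
    exact ⟨q₀, by omega, h.lt_of_lt hq (by rw [hu]; exact hn), hs, hu⟩
  | succ d ih =>
    intro q₀ hq hs hu
    have e1 : ((E * 3 ^ (d + 1) + 1 : ℤ) : ℝ) / 3 ^ (c + 1 + d) =
        E / 3 ^ c + 1 / 3 ^ (c + 1 + d) := by
      push_cast; field_simp; ring
    have e2 : (((E * 3 ^ (d + 1) + 1 : ℤ) : ℝ) - 1) / 3 ^ (c + 1 + d) = E / 3 ^ c := by
      push_cast; field_simp; ring
    have hle : (1 : ℝ) / 3 ^ (c + 1 + d) ≤ 1 / 3 ^ (c + 1) :=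
      one_div_pow_le_one_div_pow_of_le (by norm_num) (by omega)
    have hlt : (1 : ℝ) / 3 ^ (c + 1 + (d + 1)) < 1 / 3 ^ (c + 1 + d) :=
      one_div_pow_lt_one_div_pow_of_lt (by norm_num) (by omega)
    have hpos : (0 : ℝ) < 1 / 3 ^ (c + 1 + (d + 1)) := by positivity
    obtain ⟨i, hi, hin, hui⟩ := h.reach (q := E * 3 ^ (d + 1) + 1) (l := c + 1 + d) hq
      (by rw [e2, hu]; linarith) (by rw [e1, hu]; linarith) (by rw [e1]; linarith)
    have hin' : i < n := h.lt_of_lt hin (by rw [hui, e1]; linarith)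
    have hres : (E * 3 ^ (d + 1) + 1) % 3 = 1 := by rw [pow_succ, ← mul_assoc]; omega
    have := (h.2 i (by omega) hin').residue_eq_of_eq _ _ hui (by omega)
    obtain ⟨l, hl1, hl2, hl3, hl4⟩ := ih hin (by omega) (by rw [hui, e1])
    exact ⟨l, by omega, hl2, hl3, hl4⟩

theorem IsHueChain.climb_from_two {n : ℕ} {u : ℕ → ℝ} (h : IsHueChain 0 n u) (hn' : 1 ≤ n)
    {E : ℤ} {c d : ℕ} (hn : (E : ℝ) / 3 ^ c + 1 / 3 ^ (c + 1) < u n)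
    (hu : u 1 = E / 3 ^ c + 2 / 3 ^ (c + 1 + (d + 1))) :
    ∃ l, 2 * (d + 1) ≤ l ∧ l < n ∧ l % 2 = 0 ∧ u l = E / 3 ^ c + 1 / 3 ^ (c + 1) := by
  have e1 : ((E * 3 ^ (d + 1) + 1 : ℤ) : ℝ) / 3 ^ (c + 1 + d) =
      E / 3 ^ c + 1 / 3 ^ (c + 1 + d) := by
    push_cast; field_simp; ring
  have e2 : (((E * 3 ^ (d + 1) + 1 : ℤ) : ℝ) - 1) / 3 ^ (c + 1 + d) = E / 3 ^ c := by
    push_cast; field_simp; ring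
  have e3 : (1 : ℝ) / 3 ^ (c + 1 + d) = 3 / 3 ^ (c + 1 + (d + 1)) := by
    field_simp; ring
  have hle : (1 : ℝ) / 3 ^ (c + 1 + d) ≤ 1 / 3 ^ (c + 1) :=
    one_div_pow_le_one_div_pow_of_le (by norm_num) (by omega)
  have hlt : (2 : ℝ) / 3 ^ (c + 1 + (d + 1)) < 3 / 3 ^ (c + 1 + (d + 1)) := by
    gcongr; norm_num
  have hpos : (0 : ℝ) < 2 / 3 ^ (c + 1 + (d + 1)) := by positivity
  obtain ⟨i, hi, hin, hui⟩ := h.reach (q := E * 3 ^ (d + 1) + 1) (l := c + 1 + d) hn'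
    (by rw [e2, hu]; linarith) (by rw [e1, hu, e3]; linarith) (by rw [e1]; linarith)
  have hin' : i < n := h.lt_of_lt hin (by rw [hui, e1]; linarith)
  have hres : (E * 3 ^ (d + 1) + 1) % 3 = 1 := by rw [pow_succ, ← mul_assoc]; omega
  have := (h.2 i (by omega) hin').residue_eq_of_eq _ _ hui (by omega)
  obtain ⟨l, hl1, hl2, hl3, hl4⟩ := h.climb hn d hin (by omega) (by rw [hui, e1])
  exact ⟨l, by omega, hl2, by omega, hl4⟩

/-- The central piece of an admissible decomposition with more than one piece is a proper
subinterval. -/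
theorem ModelDecomp.exists_central {s M : ℕ} {J : ℝ × ℝ} {u : ℕ → ℝ} (h : ModelDecomp s J M u)
    (hM : 1 ≤ M) (hc : ModelCentered J M u) :
    ∃ i < 2 * M + 1, ∃ m : ℕ, 1 ≤ m ∧ u i = 1 / 2 - (1 / 2 - J.1) / 3 ^ m ∧
      u (i + 1) = 1 / 2 + (J.2 - 1 / 2) / 3 ^ m := by
  obtain ⟨i, hi, m, h1, h2⟩ := hc
  obtain ⟨h0, hM', h⟩ := h
  refine ⟨i, hi, m, ?_, h1, h2⟩
  by_contra! hm
  obtain rfl : m = 0 := by omega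
  have e1 : u i = u 0 := by rw [h1, h0]; ring
  have e2 : u (i + 1) = u (2 * M + 1) := by rw [h2, hM']; ring
  rcases Nat.eq_zero_or_pos i with rfl | hi'
  · have := h.lt (show 0 + 1 < 2 * M + 1 by omega) le_rfl
    linarith
  · have := h.lt hi' hi.le
    linarith

theorem div_three_pow_le {x : ℝ} (hx : 0 ≤ x) {m : ℕ} (hm : 1 ≤ m) : x / 3 ^ m ≤ x / 3 := by
  have : (3 : ℝ) ≤ 3 ^ m := by
    calc (3 : ℝ) = 3 ^ 1 := by norm_num
      _ ≤ 3 ^ m := pow_le_pow_right₀ (by norm_num) hm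
  gcongr

theorem ModelDecomp.interior {s M : ℕ} {J : ℝ × ℝ} {u : ℕ → ℝ} (h : ModelDecomp s J M u)
    (hM : 1 ≤ M) : J.1 < u 1 ∧ u 1 < J.2 ∧ HasHue (s + 1) (u 1) ∧ IsPiece J.1 (u 1) := by
  obtain ⟨h0, hM', h⟩ := h
  refine ⟨h0 ▸ h.lt (by omega) (by omega), hM' ▸ h.lt (by omega) le_rfl,
    h.2 1 (by omega) (by omega), h0 ▸ h.1 0 (by omega)⟩

theorem firstPiece_of_zero {t : ℕ} {v : ℝ} (h : IsPiece 0 v) (hv : HasHue t v) :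
    (t % 2 = 0 ∧ ∃ j : ℕ, 1 ≤ j ∧ v = 1 / 3 ^ j) ∨ (t % 2 = 1 ∧ ∃ j : ℕ, 1 ≤ j ∧ v = 2 / 3 ^ j) := by
  obtain ⟨J, hJ, m, k, h1, h2⟩ := h
  have h1' : (k : ℝ) + J.1 = 0 := by
    rcases div_eq_zero_iff.1 h1.symm with h | h
    · exact h
    · exact absurd h (by positivity)
  have key : 3 * (k : ℝ) = -(3 * J.1) := by linarith
  rcases hJ with rfl | rfl | rfl
  · obtain rfl : k = 0 := by simpa using h1'
    have h3 : v = 1 / 3 ^ m := by simpa using h2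
    have hm : 1 ≤ m := by
      by_contra! hm
      obtain rfl : m = 0 := by omega
      exact not_hasHue_int t 1 (by simpa [h3] using hv)
    have := hv.residue_eq_of_eq 1 m (by simpa using h3) (by norm_num)
    exact Or.inl ⟨by omega, m, hm, h3⟩
  · obtain rfl : k = 0 := by simpa using h1'
    have h3 : v = 2 / 3 ^ (m + 1) := by rw [h2, pow_succ]; push_cast; field_simp; ring
    have := hv.residue_eq_of_eq 2 (m + 1) (by simpa using h3) (by norm_num)
    exact Or.inr ⟨by omega, m + 1, by omega, h3⟩
  · have : 3 * (k : ℝ) = -1 := by rw [key]; norm_num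
    norm_cast at this
    omega

theorem firstPiece_of_third {v : ℝ} (h : IsPiece (1 / 3) v) (hv : HasHue 1 v) :
    v = 2 / 3 ∨ ∃ j : ℕ, 1 ≤ j ∧ v = 1 / 3 + 2 / 3 ^ (j + 1) := by
  obtain ⟨J, hJ, m, k, h1, h2⟩ := h
  rw [div_eq_div_iff (by norm_num) (by positivity)] at h1
  rcases hJ with rfl | rfl | rfl
  · have h1' : 3 ^ m = k * 3 := by
      have : (3 : ℝ) ^ m = k * 3 := by linarith
      exact_mod_cast this
    rcases m with _ | m
    · omega
    have hk : k = 3 ^ m := by rw [pow_succ] at h1'; omega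
    rcases m with _ | m
    · left; rw [h2, hk]; norm_num
    · exfalso
      have hres : ((3 : ℤ) ^ (m + 1) + 1) % 3 = 1 := by rw [pow_succ]; omega
      have := hv.residue_eq_of_eq (3 ^ (m + 1) + 1) (m + 1 + 1) (by rw [h2, hk]; push_cast; rfl)
        (by omega)
      omega
  · have h1' : 3 ^ m = k * 3 := by
      have : (3 : ℝ) ^ m = k * 3 := by linarith
      exact_mod_cast this
    rcases m with _ | m
    · omega
    have hk : k = 3 ^ m := by rw [pow_succ] at h1'; omega
    right
    refine ⟨m + 1, by omega, ?_⟩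
    rw [h2, hk]
    push_cast
    field_simp
    ring
  · have h1' : 3 ^ m = 3 * k + 1 := by
      have : (3 : ℝ) ^ m = 3 * k + 1 := by linarith
      exact_mod_cast this
    rcases m with _ | m
    · exfalso
      obtain rfl : k = 0 := by omega
      exact not_hasHue_int 1 1 (by simpa [h2] using hv)
    · rw [pow_succ] at h1'
      omega

theorem ModelDecomp.firstPoint_A1 {M : ℕ} {u : ℕ → ℝ} (h : ModelDecomp 0 (0, 1) M u)
    (hM : 1 ≤ M) : ∃ j : ℕ, 1 ≤ j ∧ u 1 = 2 / 3 ^ j ∧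
      (2 ≤ j → ∃ l, 2 * (j - 1) ≤ l ∧ l < 2 * M + 1 ∧ l % 2 = 0 ∧ u l = 1 / 3) := by
  obtain ⟨h1, h2, h3, h4⟩ := h.interior hM
  obtain ⟨h0, hM', hc⟩ := h
  rcases firstPiece_of_zero h4 h3 with ⟨ht, -⟩ | ⟨-, j, hj, hu⟩
  · omega
  refine ⟨j, hj, hu, fun hj2 => ?_⟩
  obtain ⟨d, rfl⟩ := Nat.exists_eq_add_of_le' hj2
  obtain ⟨l, hl1, hl2, hl3, hl4⟩ := hc.climb_from_two (E := 0) (c := 0) (d := d) (by omega)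
    (by rw [hM']; norm_num) (by rw [hu, show 0 + 1 + (d + 1) = d + 2 by omega]; norm_num)
  exact ⟨l, by omega, hl2, hl3, by rw [hl4]; norm_num⟩

theorem ModelDecomp.bound_A1 {M : ℕ} {u : ℕ → ℝ} (h : ModelDecomp 0 (0, 1) M u)
    (hM : 1 ≤ M) : ∃ j : ℕ, 1 ≤ j ∧ j ≤ M + 1 ∧ u 1 = 2 / 3 ^ j := by
  obtain ⟨j, hj, hu, hl⟩ := h.firstPoint_A1 hM
  refine ⟨j, hj, ?_, hu⟩
  by_contra! hj'
  obtain ⟨l, hl1, hl2, -⟩ := hl (by omega)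
  omega

theorem ModelDecomp.boundAdm_A1 {M : ℕ} {u : ℕ → ℝ} (h : ModelDecomp 0 (0, 1) M u)
    (hM : 1 ≤ M) (hc : ModelCentered (0, 1) M u) :
    ∃ j : ℕ, 2 ≤ j ∧ j ≤ M ∧ u 1 = 2 / 3 ^ j := by
  obtain ⟨j, hj, hu, hl⟩ := h.firstPoint_A1 hM
  obtain ⟨i, hi, m, hm, hi1, hi2⟩ := h.exists_central hM hc
  obtain ⟨h0, hM', hch⟩ := h
  have hm1 : (1 / 2 - 0 : ℝ) / 3 ^ m ≤ (1 / 2 - 0) / 3 := div_three_pow_le (by norm_num) hm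
  have hm2 : (1 - 1 / 2 : ℝ) / 3 ^ m ≤ (1 - 1 / 2) / 3 := div_three_pow_le (by norm_num) hm
  have hm3 : (0 : ℝ) < (1 / 2 - 0) / 3 ^ m := by positivity
  have hm4 : (0 : ℝ) < (1 - 1 / 2) / 3 ^ m := div_pos (by norm_num) (by positivity)
  simp only at hi1 hi2 h0 hM'
  have hj2 : 2 ≤ j := by
    by_contra! hj2
    obtain rfl : j = 1 := by omega
    rcases Nat.eq_zero_or_pos i with rfl | hi'
    · linarith
    · have := hch.le hi' hi.le
      norm_num at hu
      linarith
  refine ⟨j, hj2, ?_, hu⟩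
  obtain ⟨l, hl1, hl2, hl3, hl4⟩ := hl hj2
  obtain ⟨l', hl1', hl2'⟩ : ∃ l', l' ≤ 2 * M + 1 ∧ u l' = 2 / 3 := by
    rcases eq_or_lt_of_le (show u (i + 1) ≤ 2 / 3 by linarith) with h1 | h1
    · exact ⟨i + 1, hi, h1⟩
    · obtain ⟨l', -, h2, h3⟩ := hch.reach (q := 2) (l := 1) (i₀ := i + 1) hi
        (by norm_num; linarith) (by norm_num; linarith) (by rw [hM']; norm_num)
      exact ⟨l', h2, by rw [h3]; norm_num⟩
  have hlt := hch.lt_of_lt hl2.le (show u l < u l' by rw [hl4, hl2']; norm_num)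
  have hlt' := hch.lt_of_lt hl1' (show u l' < u (2 * M + 1) by rw [hM', hl2']; norm_num)
  have := (hch.2 l' (by omega) hlt').residue_eq_of_eq 2 1 (by rw [hl2']; norm_num) (by norm_num)
  omega

theorem ModelDecomp.bound_A2 {M : ℕ} {u : ℕ → ℝ} (h : ModelDecomp 1 (0, 1) M u)
    (hM : 1 ≤ M) : ∃ j : ℕ, 1 ≤ j ∧ j ≤ M ∧ u 1 = 1 / 3 ^ j := by
  obtain ⟨h1, h2, h3, h4⟩ := h.interior hM
  obtain ⟨h0, hM', hc⟩ := h
  rcases firstPiece_of_zero h4 h3 with ⟨-, j, hj, hu⟩ | ⟨ht, -⟩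
  · refine ⟨j, hj, ?_, hu⟩
    obtain ⟨d, rfl⟩ := Nat.exists_eq_add_of_le' hj
    obtain ⟨l, hl1, hl2, hl3, hl4⟩ := hc.climb (E := 0) (c := 0) (by rw [hM']; norm_num) d
      (q₀ := 1) (by omega) (by norm_num)
      (by rw [hu, show 0 + 1 + d = d + 1 by omega]; norm_num)
    omega
  · omega

theorem ModelDecomp.firstPoint_B {M : ℕ} {u : ℕ → ℝ} (h : ModelDecomp 0 (0, 2 / 3) M u)
    (hM : 1 ≤ M) : ∃ j : ℕ, 1 ≤ j ∧ u 1 = 2 / 3 ^ (j + 1) ∧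
      ∃ l, 2 * j ≤ l ∧ l < 2 * M + 1 ∧ l % 2 = 0 ∧ u l = 1 / 3 := by
  obtain ⟨h1, h2, h3, h4⟩ := h.interior hM
  obtain ⟨h0, hM', hc⟩ := h
  rcases firstPiece_of_zero h4 h3 with ⟨ht, -⟩ | ⟨-, j, hj, hu⟩
  · omega
  rcases j with _ | _ | d
  · omega
  · norm_num [hu] at h2
  refine ⟨d + 1, by omega, hu, ?_⟩
  obtain ⟨l, hl1, hl2, hl3, hl4⟩ := hc.climb_from_two (E := 0) (c := 0) (d := d) (by omega)
    (by rw [hM']; norm_num) (by rw [hu, show 0 + 1 + (d + 1) = d + 1 + 1 by omega]; norm_num)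
  exact ⟨l, by omega, hl2, hl3, by rw [hl4]; norm_num⟩

theorem ModelDecomp.bound_B {M : ℕ} {u : ℕ → ℝ} (h : ModelDecomp 0 (0, 2 / 3) M u)
    (hM : 1 ≤ M) : ∃ j : ℕ, 1 ≤ j ∧ j ≤ M ∧ u 1 = 2 / 3 ^ (j + 1) := by
  obtain ⟨j, hj, hu, l, hl1, hl2, -⟩ := h.firstPoint_B hM
  exact ⟨j, hj, by omega, hu⟩

theorem ModelDecomp.boundAdm_B {M : ℕ} {u : ℕ → ℝ} (h : ModelDecomp 0 (0, 2 / 3) M u)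
    (hM : 1 ≤ M) (hc : ModelCentered (0, 2 / 3) M u) :
    ∃ j : ℕ, 1 ≤ j ∧ j ≤ M - 1 ∧ u 1 = 2 / 3 ^ (j + 1) := by
  obtain ⟨j, hj, hu, l, hl1, hl2, hl3, hl4⟩ := h.firstPoint_B hM
  obtain ⟨i, hi, m, hm, hi1, hi2⟩ := h.exists_central hM hc
  obtain ⟨h0, hM', hch⟩ := h
  have hm2 : (2 / 3 - 1 / 2 : ℝ) / 3 ^ m ≤ (2 / 3 - 1 / 2) / 3 :=
    div_three_pow_le (by norm_num) hm
  have hm4 : (0 : ℝ) < (2 / 3 - 1 / 2) / 3 ^ m := div_pos (by norm_num) (by positivity)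
  simp only at hi1 hi2 h0 hM'
  have h1 := hch.lt_of_lt hl2.le (show u l < u (i + 1) by linarith)
  have h2 := hch.lt_of_lt hi (show u (i + 1) < u (2 * M + 1) by linarith)
  exact ⟨j, hj, by omega, hu⟩

theorem ModelDecomp.bound_C {M : ℕ} {u : ℕ → ℝ} (h : ModelDecomp 0 (1 / 3, 1) M u)
    (hM : 1 ≤ M) : u 1 = 2 / 3 ∨ ∃ j : ℕ, 1 ≤ j ∧ j ≤ M ∧ u 1 = 1 / 3 + 2 / 3 ^ (j + 1) := by
  obtain ⟨h1, h2, h3, h4⟩ := h.interior hM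
  obtain ⟨h0, hM', hc⟩ := h
  rcases firstPiece_of_third h4 h3 with hu | ⟨j, hj, hu⟩
  · exact Or.inl hu
  refine Or.inr ⟨j, hj, ?_, hu⟩
  rcases j with _ | _ | d
  · omega
  · omega
  obtain ⟨l, hl1, hl2, hl3, hl4⟩ := hc.climb_from_two (E := 1) (c := 1) (d := d) (by omega)
    (by rw [hM']; norm_num) (by rw [hu, show 1 + 1 + (d + 1) = d + 1 + 1 + 1 by omega]; norm_num)
  obtain ⟨l', hlt, hl1', hl2'⟩ := hc.reach (q := 2) (l := 1) (i₀ := l) hl2.le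
    (by rw [hl4]; norm_num) (by rw [hl4]; norm_num) (by rw [hM']; norm_num)
  have hlt' := hc.lt_of_lt hl1' (show u l' < u (2 * M + 1) by rw [hM', hl2']; norm_num)
  have := (hc.2 l' (by omega) hlt').residue_eq_of_eq 2 1 hl2' (by norm_num)
  omega

theorem ModelDecomp.boundAdm_C {M : ℕ} {u : ℕ → ℝ} (h : ModelDecomp 0 (1 / 3, 1) M u)
    (hM : 1 ≤ M) (hc : ModelCentered (1 / 3, 1) M u) :
    ∃ j : ℕ, 2 ≤ j ∧ j ≤ M ∧ u 1 = 1 / 3 + 2 / 3 ^ (j + 1) := by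
  obtain ⟨i, hi, m, hm, hi1, hi2⟩ := h.exists_central hM hc
  have hm1 : (1 / 2 - 1 / 3 : ℝ) / 3 ^ m ≤ (1 / 2 - 1 / 3) / 3 :=
    div_three_pow_le (by norm_num) hm
  have hm3 : (0 : ℝ) < (1 / 2 - 1 / 3) / 3 ^ m := div_pos (by norm_num) (by positivity)
  have hu : u 1 ≤ 1 / 2 := by
    rcases Nat.eq_zero_or_pos i with rfl | hi'
    · have h0 := h.1
      simp only at h0 hi1
      linarith
    · have := h.2.2.le hi' hi.le
      simp only at hi1
      linarith
  rcases h.bound_C hM with h1 | ⟨j, hj, hjM, h1⟩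
  · norm_num [h1] at hu
  · refine ⟨j, ?_, hjM, h1⟩
    by_contra! hj2
    obtain rfl : j = 1 := by omega
    norm_num [h1] at hu

theorem IsHueChain.append {s t n m : ℕ} {x y : ℕ → ℝ} (hx : IsHueChain s n x)
    (hy : IsHueChain t m y) (ht : t % 2 = (s + n) % 2) (hxy : x n = y 0)
    (hhue : HasHue t (y 0)) :
    ∃ z : ℕ → ℝ, (∀ i ≤ n, z i = x i) ∧ (∀ i, z (n + i) = y i) ∧ IsHueChain s (n + m) z := by
  have hz1 : ∀ i ≤ n, (fun i => if i ≤ n then x i else y (i - n)) i = x i := fun i hi => if_pos hi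
  have hz2 : ∀ i, (fun i => if i ≤ n then x i else y (i - n)) (n + i) = y i := by
    intro i
    rcases Nat.eq_zero_or_pos i with rfl | hi
    · simpa using hxy
    · simp [hi.ne']
  generalize (fun i => if i ≤ n then x i else y (i - n)) = z at hz1 hz2
  refine ⟨z, hz1, hz2, fun i hi => ?_, fun i hi hi' => ?_⟩
  · rcases lt_or_ge i n with h | h
    · rw [hz1 i h.le, hz1 (i + 1) h]
      exact hx.1 i h
    · obtain ⟨j, rfl⟩ := Nat.exists_eq_add_of_le h
      rw [hz2, add_assoc, hz2]
      exact hy.1 j (by omega)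
  · rcases lt_or_ge i n with h | h
    · rw [hz1 i h.le]
      exact hx.2 i hi h
    · obtain ⟨j, rfl⟩ := Nat.exists_eq_add_of_le h
      rw [hz2]
      rcases Nat.eq_zero_or_pos j with rfl | hj
      · exact hhue.congr (by omega)
      · exact (hy.2 j hj (by omega)).congr (by omega)

/-- There is a chain of `n` R-intervals from `u` to `v`, starting with hue `s`. -/
def HasPath (s n : ℕ) (u v : ℝ) : Prop := ∃ x : ℕ → ℝ, x 0 = u ∧ x n = v ∧ IsHueChain s n x

theorem HasPath.trans {s t n m N : ℕ} {u v w : ℝ} (h₁ : HasPath s n u v) (hv : HasHue t v)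
    (h₂ : HasPath t m v w) (ht : t % 2 = (s + n) % 2) (hN : N = n + m) : HasPath s N u w := by
  obtain ⟨x, hx0, hxn, hx⟩ := h₁
  obtain ⟨y, hy0, hym, hy⟩ := h₂
  obtain ⟨z, hz1, hz2, hz⟩ := hx.append hy ht (hxn.trans hy0.symm) (by rwa [hy0])
  subst hN
  exact ⟨z, by rw [hz1 0 (Nat.zero_le n), hx0], by rw [hz2, hym], hz⟩

theorem IsPiece.hasPath {u v : ℝ} (h : IsPiece u v) (s : ℕ) : HasPath s 1 u v := by
  refine ⟨fun i => if i = 0 then u else v, by simp, by simp, fun i hi => ?_, fun i _ _ => by omega⟩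
  obtain rfl : i = 0 := by omega
  simpa using h

theorem HasPath.refl (s : ℕ) (u : ℝ) : HasPath s 0 u u :=
  ⟨fun _ => u, rfl, rfl, fun _ hi => absurd hi (Nat.not_lt_zero _),
    fun _ _ hi => absurd hi (Nat.not_lt_zero _)⟩

theorem isPiece_full (k : ℤ) (m : ℕ) {u v : ℝ} (hu : u = k / 3 ^ m) (hv : v = (k + 1) / 3 ^ m) :
    IsPiece u v :=
  ⟨(0, 1), by simp [rTypes], m, k, by simpa using hu, hv⟩

theorem isPiece_left (k : ℤ) (m : ℕ) {u v : ℝ} (hu : u = k / 3 ^ m)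
    (hv : v = (k + 2 / 3) / 3 ^ m) : IsPiece u v :=
  ⟨(0, 2 / 3), by simp [rTypes], m, k, by simpa using hu, hv⟩

theorem isPiece_right (k : ℤ) (m : ℕ) {u v : ℝ} (hu : u = (k + 1 / 3) / 3 ^ m)
    (hv : v = (k + 1) / 3 ^ m) : IsPiece u v :=
  ⟨(1 / 3, 1), by simp [rTypes], m, k, hu, hv⟩

/-- A type A interval from blue to red can be cut into any odd number of pieces. -/
theorem hasPath_full (r : ℕ) : ∀ (k : ℤ) (m : ℕ) {u v : ℝ}, u = k / 3 ^ m → v = (k + 1) / 3 ^ m →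
    HasPath 1 (2 * r + 1) u v := by
  induction r with
  | zero => exact fun k m u v hu hv => (isPiece_full k m hu hv).hasPath 1
  | succ r ih =>
    intro k m u v hu hv
    have p₁ : IsPiece u ((3 * k + 1) / 3 ^ (m + 1)) :=
      isPiece_full (3 * k) (m + 1) (by rw [hu]; push_cast; field_simp; ring) (by push_cast; rfl)
    have p₂ : IsPiece ((3 * k + 1) / 3 ^ (m + 1)) ((3 * k + 2) / 3 ^ (m + 1)) :=
      isPiece_full (3 * k + 1) (m + 1) (by push_cast; rfl) (by push_cast; ring)
    refine (p₁.hasPath 1).trans (t := 2) ⟨3 * k + 1, m + 1, by omega, by omega, by push_cast; rfl⟩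
      ?_ (by omega) (show 2 * (r + 1) + 1 = 1 + (2 * r + 2) by ring)
    refine (p₂.hasPath 2).trans (t := 1) ⟨3 * k + 2, m + 1, by omega, by omega, by push_cast; rfl⟩
      ?_ (by omega) (show 2 * r + 2 = 1 + (2 * r + 1) by ring)
    exact ih (3 * k + 2) (m + 1) (by push_cast; rfl) (by rw [hv]; push_cast; field_simp; ring)

/-- A type A interval from blue to blue can be cut into any positive even number of pieces. -/
theorem hasPath_full_even (r : ℕ) (q : ℤ) (m : ℕ) {u v : ℝ} (hu : u = q / 3 ^ m)
    (hv : v = (q + 1) / 3 ^ m) : HasPath 1 (2 * r + 2) u v := by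
  have p : HasPath 1 (2 * r + 1) u ((3 * q + 1) / 3 ^ (m + 1)) :=
    hasPath_full r (3 * q) (m + 1) (by rw [hu]; push_cast; field_simp; ring) (by push_cast; rfl)
  exact p.trans (t := 2) ⟨3 * q + 1, m + 1, by omega, by omega, by push_cast; rfl⟩
    ((isPiece_right q m (by field_simp; ring) hv).hasPath 2) (by omega) (by ring)

/-- Climbing back from the left end of an interval. -/
theorem hasPath_climb (E : ℤ) (c r d : ℕ) :
    HasPath 1 (2 * d + 1 + 2 * r) (E / 3 ^ c + 2 / 3 ^ (c + 2 + d))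
      (E / 3 ^ c + 1 / 3 ^ (c + 1)) := by
  induction d with
  | zero =>
    rw [show 2 * 0 + 1 + 2 * r = 2 * r + 1 by ring]
    exact hasPath_full r (9 * E + 2) (c + 2) (by push_cast; field_simp; ring)
      (by push_cast; field_simp; ring)
  | succ d ih =>
    have p₁ : IsPiece ((E : ℝ) / 3 ^ c + 2 / 3 ^ (c + 2 + (d + 1)))
        (E / 3 ^ c + 1 / 3 ^ (c + 2 + d)) :=
      isPiece_full (3 ^ (d + 3) * E + 2) (c + 2 + (d + 1)) (by push_cast; field_simp; ring)
        (by push_cast; field_simp; ring)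
    have p₂ : IsPiece ((E : ℝ) / 3 ^ c + 1 / 3 ^ (c + 2 + d)) (E / 3 ^ c + 2 / 3 ^ (c + 2 + d)) :=
      isPiece_full (3 ^ (d + 2) * E + 1) (c + 2 + d) (by push_cast; field_simp; ring)
        (by push_cast; field_simp; ring)
    refine (p₁.hasPath 1).trans (t := 2) ⟨3 ^ (d + 2) * E + 1, c + 2 + d, by omega, ?_, ?_⟩
      ?_ (by omega) (show 2 * (d + 1) + 1 + 2 * r = 1 + (2 * d + 1 + 2 * r + 1) by ring)
    · rw [pow_succ, mul_comm _ (3 : ℤ), mul_assoc]; omega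
    · push_cast; field_simp; ring
    refine (p₂.hasPath 2).trans (t := 1) ⟨3 ^ (d + 2) * E + 2, c + 2 + d, by omega, ?_, ?_⟩
      ih (by omega) (by ring)
    · rw [pow_succ, mul_comm _ (3 : ℤ), mul_assoc]; omega
    · push_cast; field_simp; ring

theorem exists_modelDecomp {s M : ℕ} {J : ℝ × ℝ} {f : ℝ} (hf : IsPiece J.1 f)
    (hhue : HasHue (s + 1) f) (h : HasPath (s + 1) (2 * M) f J.2) :
    ∃ u, ModelDecomp s J M u ∧ u 1 = f := by
  obtain ⟨x, hx0, hx1, hx⟩ := hf.hasPath s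
  obtain ⟨y, hy0, hym, hy⟩ := h
  obtain ⟨z, hz1, hz2, hz⟩ := hx.append hy rfl (hx1.trans hy0.symm) (by rwa [hy0])
  rw [add_comm 1] at hz
  exact ⟨z, ⟨by rw [hz1 0 (by omega), hx0], by rw [add_comm _ 1, hz2, hym], hz⟩,
    by rw [hz1 1 le_rfl, hx1]⟩

theorem exists_modelDecomp_centered {s M n₁ n₂ : ℕ} {J : ℝ × ℝ} {f c d : ℝ} (hf : IsPiece J.1 f)
    (hhf : HasHue (s + 1) f) (h₁ : HasPath (s + 1) n₁ f c) (hhc : HasHue (s + 1 + n₁) c)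
    (hcd : IsPiece c d) (hhd : HasHue (s + n₁) d) (h₂ : HasPath (s + n₁) n₂ d J.2)
    (hn : n₁ + n₂ + 1 = 2 * M) (hc : c = 1 / 2 - (1 / 2 - J.1) / 3)
    (hd : d = 1 / 2 + (J.2 - 1 / 2) / 3) :
    ∃ u, (ModelDecomp s J M u ∧ ModelCentered J M u) ∧ u 1 = f := by
  obtain ⟨w, hw0, hw1, hw⟩ := hcd.hasPath (s + 1 + n₁)
  obtain ⟨v, hv0, hvm, hv⟩ := h₂
  obtain ⟨y, hy1, hy2, hy⟩ := hw.append hv (by omega) (hw1.trans hv0.symm) (by rwa [hv0])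
  obtain ⟨fx, hfx0, hfx1, hfx⟩ := hf.hasPath s
  obtain ⟨g, hg0, hgm, hg⟩ := h₁
  obtain ⟨x, hx1, hx2, hx⟩ := hfx.append hg rfl (hfx1.trans hg0.symm) (by rwa [hg0])
  have hy0 : y 0 = c := by rw [hy1 0 (by omega), hw0]
  have hxe : x (1 + n₁) = c := by rw [hx2, hgm]
  obtain ⟨z, hz1, hz2, hz⟩ := hx.append hy (by omega) (hxe.trans hy0.symm) (by rwa [hy0])
  have hN : 1 + n₁ + (1 + n₂) = 2 * M + 1 := by omega
  rw [hN] at hz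
  refine ⟨z, ⟨⟨by rw [hz1 0 (by omega), hx1 0 (by omega), hfx0], ?_, hz⟩,
    1 + n₁, by omega, 1, ?_, ?_⟩, by rw [hz1 1 (by omega), hx1 1 le_rfl, hfx1]⟩
  · rw [← hN, hz2, hy2, hvm]
  · rw [hz1 _ le_rfl, hxe, hc, pow_one]
  · rw [hz2, hy1 1 le_rfl, hw1, hd, pow_one]


theorem HasPath.congr {s t n : ℕ} {u v : ℝ} (h : HasPath s n u v) (hst : s % 2 = t % 2) :
    HasPath t n u v := by
  obtain ⟨x, hx0, hxn, hx⟩ := h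
  exact ⟨x, hx0, hxn, hx.1, fun i hi hi' => (hx.2 i hi hi').congr (by omega)⟩

theorem hasPath_climb_zero (r d : ℕ) :
    HasPath 1 (2 * d + 1 + 2 * r) (2 / 3 ^ (d + 2)) (1 / 3) := by
  simpa [add_comm 2 d] using hasPath_climb 0 0 r d

theorem hasHue_two_div (t k : ℕ) (ht : t % 2 = 1) : HasHue t (2 / 3 ^ (k + 1)) :=
  ⟨2, k + 1, by omega, by rw [ht]; norm_num, by norm_num⟩

theorem hasHue_one_div (t k : ℕ) (ht : t % 2 = 0) : HasHue t (1 / 3 ^ (k + 1)) :=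
  ⟨1, k + 1, by omega, by rw [ht]; norm_num, by norm_num⟩

theorem hasHue_two_thirds {t : ℕ} (ht : t % 2 = 1) : HasHue t (2 / 3) := by
  simpa using hasHue_two_div t 0 ht

theorem hasHue_one_third {t : ℕ} (ht : t % 2 = 0) : HasHue t (1 / 3) := by
  simpa using hasHue_one_div t 0 ht

theorem isPiece_zero_two_div (k : ℕ) : IsPiece 0 (2 / 3 ^ (k + 1)) :=
  isPiece_left 0 k (by simp) (by push_cast; field_simp; ring)

theorem hasPath_last_third_even (r : ℕ) : HasPath 1 (2 * r + 2) (2 / 3) 1 :=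
  hasPath_full_even r 2 1 (by norm_num) (by norm_num)

theorem exists_A1 {M j : ℕ} (hM : 1 ≤ M) (hj : 1 ≤ j) (hjM : j ≤ M + 1) :
    ∃ u, ModelDecomp 0 (0, 1) M u ∧ u 1 = 2 / 3 ^ j := by
  obtain ⟨d, rfl⟩ := Nat.exists_eq_add_of_le' hj
  refine exists_modelDecomp (isPiece_zero_two_div d) (hasHue_two_div _ _ rfl) ?_
  rcases d with _ | d
  · obtain ⟨r, rfl⟩ := Nat.exists_eq_add_of_le' hM
    simpa [mul_add] using hasPath_last_third_even r
  · obtain ⟨r, hr⟩ := Nat.exists_eq_add_of_le hjM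
    exact (hasPath_climb_zero r d).trans (t := 2) (hasHue_one_third rfl)
      ((isPiece_right 0 0 (by norm_num) (by norm_num)).hasPath 2) (by omega) (by omega)

theorem existsAdm_A1 {M j : ℕ} (hj : 2 ≤ j) (hjM : j ≤ M) :
    ∃ u, (ModelDecomp 0 (0, 1) M u ∧ ModelCentered (0, 1) M u) ∧ u 1 = 2 / 3 ^ j := by
  obtain ⟨d, rfl⟩ := Nat.exists_eq_add_of_le' hj
  obtain ⟨r, hr⟩ := Nat.exists_eq_add_of_le hjM
  exact exists_modelDecomp_centered (c := 1 / 3) (d := 2 / 3) (n₁ := 2 * d + 1 + 2 * 0)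
    (n₂ := 2 * r + 2) (isPiece_zero_two_div (d + 1)) (hasHue_two_div _ _ rfl)
    (hasPath_climb_zero 0 d) (hasHue_one_third (by omega))
    (isPiece_full 1 1 (by norm_num) (by norm_num)) (hasHue_two_thirds (by omega))
    ((hasPath_last_third_even r).congr (by omega)) (by omega) (by norm_num) (by norm_num)

theorem existsAdm_A2 {M j : ℕ} (hj : 1 ≤ j) (hjM : j ≤ M) :
    ∃ u, (ModelDecomp 1 (0, 1) M u ∧ ModelCentered (0, 1) M u) ∧ u 1 = 1 / 3 ^ j := by
  obtain ⟨d, rfl⟩ := Nat.exists_eq_add_of_le' hj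
  obtain ⟨r, hr⟩ := Nat.exists_eq_add_of_le hjM
  have hp : HasPath 2 (2 * d) (1 / 3 ^ (d + 1)) (1 / 3) := by
    rcases d with _ | d
    · simpa using HasPath.refl 2 (1 / 3)
    · exact ((isPiece_full 1 (d + 2) (by norm_num) (by norm_num)).hasPath 2).trans (t := 1)
        (hasHue_two_div _ (d + 1) rfl) (hasPath_climb_zero 0 d) (by omega) (by omega)
  exact exists_modelDecomp_centered (c := 1 / 3) (d := 2 / 3) (n₁ := 2 * d) (n₂ := 2 * r + 1)
    (isPiece_full 0 (d + 1) (by simp) (by simp)) (hasHue_one_div _ _ rfl) hp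
    (hasHue_one_third (by omega)) (isPiece_full 1 1 (by norm_num) (by norm_num))
    (hasHue_two_thirds (by omega))
    ((hasPath_full r 2 1 (by norm_num) (by norm_num)).congr (by omega)) (by omega)
    (by norm_num) (by norm_num)

theorem exists_B {M j : ℕ} (hj : 1 ≤ j) (hjM : j ≤ M) :
    ∃ u, ModelDecomp 0 (0, 2 / 3) M u ∧ u 1 = 2 / 3 ^ (j + 1) := by
  obtain ⟨d, rfl⟩ := Nat.exists_eq_add_of_le' hj
  obtain ⟨r, hr⟩ := Nat.exists_eq_add_of_le hjM
  refine exists_modelDecomp (isPiece_zero_two_div (d + 1)) (hasHue_two_div _ _ rfl) ?_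
  exact (hasPath_climb_zero r d).trans (t := 2) (hasHue_one_third rfl)
    ((isPiece_full 1 1 (by norm_num) (by norm_num)).hasPath 2) (by omega) (by omega)

theorem existsAdm_B {M j : ℕ} (hj : 1 ≤ j) (hjM : j ≤ M - 1) :
    ∃ u, (ModelDecomp 0 (0, 2 / 3) M u ∧ ModelCentered (0, 2 / 3) M u) ∧
      u 1 = 2 / 3 ^ (j + 1) := by
  obtain ⟨d, rfl⟩ := Nat.exists_eq_add_of_le' hj
  obtain ⟨r, hr⟩ := Nat.exists_eq_add_of_le hjM
  exact exists_modelDecomp_centered (c := 1 / 3) (d := 5 / 9) (n₁ := 2 * d + 1 + 2 * 0)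
    (n₂ := 2 * r + 2) (isPiece_zero_two_div (d + 1)) (hasHue_two_div _ _ rfl)
    (hasPath_climb_zero 0 d) (hasHue_one_third (by omega))
    (isPiece_left 1 1 (by norm_num) (by norm_num))
    (HasHue.congr (s := 1) ⟨5, 2, by norm_num, by norm_num, by norm_num⟩ (by omega))
    ((hasPath_full_even r 5 2 (by norm_num) (by norm_num)).congr (by omega)) (by omega)
    (by norm_num) (by norm_num)

theorem exists_C_half {M : ℕ} (hM : 1 ≤ M) :
    ∃ u, ModelDecomp 0 (1 / 3, 1) M u ∧ u 1 = 2 / 3 := by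
  obtain ⟨r, rfl⟩ := Nat.exists_eq_add_of_le' hM
  exact exists_modelDecomp (isPiece_full 1 1 (by norm_num) (by norm_num)) (hasHue_two_thirds rfl)
    (hasPath_last_third_even r)

theorem existsAdm_C {M j : ℕ} (hj : 2 ≤ j) (hjM : j ≤ M) :
    ∃ u, (ModelDecomp 0 (1 / 3, 1) M u ∧ ModelCentered (1 / 3, 1) M u) ∧
      u 1 = 1 / 3 + 2 / 3 ^ (j + 1) := by
  obtain ⟨d, rfl⟩ := Nat.exists_eq_add_of_le' hj
  obtain ⟨r, hr⟩ := Nat.exists_eq_add_of_le hjM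
  have hp : HasPath 1 (2 * d + 1 + 2 * 0) (1 / 3 + 2 / 3 ^ (d + 2 + 1)) (4 / 9) := by
    convert hasPath_climb 1 1 0 d using 1
    · norm_num [show 1 + 2 + d = d + 2 + 1 by ring]
    · norm_num
  refine exists_modelDecomp_centered (c := 4 / 9) (d := 2 / 3) (n₁ := 2 * d + 1 + 2 * 0)
    (n₂ := 2 * r + 2) (isPiece_left (3 ^ (d + 1)) (d + 2) ?_ ?_)
    ⟨3 ^ (d + 2) + 2, d + 2 + 1, by omega, ?_, ?_⟩ hp
    (HasHue.congr (s := 0) ⟨4, 2, by norm_num, by norm_num, by norm_num⟩ (by omega))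
    (isPiece_right 1 1 (by norm_num) (by norm_num)) (hasHue_two_thirds (by omega))
    ((hasPath_last_third_even r).congr (by omega)) (by omega)
    (by norm_num) (by norm_num)
  · push_cast; field_simp; ring
  · push_cast; field_simp; ring
  · rw [pow_succ]; omega
  · push_cast; field_simp; ring

theorem exists_C {M j : ℕ} (hM : 2 ≤ M) (hj : 1 ≤ j) (hjM : j ≤ M) :
    ∃ u, ModelDecomp 0 (1 / 3, 1) M u ∧ u 1 = 1 / 3 + 2 / 3 ^ (j + 1) := by
  rcases hj.eq_or_lt with rfl | hj
  · obtain ⟨r, rfl⟩ := Nat.exists_eq_add_of_le' hM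
    rw [show (1 / 3 + 2 / 3 ^ (1 + 1) : ℝ) = 5 / 9 by norm_num]
    refine exists_modelDecomp (isPiece_left 1 1 (by norm_num) (by norm_num))
      ⟨5, 2, by norm_num, by norm_num, by norm_num⟩ ?_
    exact (hasPath_full_even 0 5 2 (by norm_num) (v := 2 / 3) (by norm_num)).trans (t := 1)
      (hasHue_two_thirds rfl) (hasPath_last_third_even r) rfl (by omega)
  · obtain ⟨u, hu, h1⟩ := existsAdm_C hj hjM
    exact ⟨u, hu.1, h1⟩

theorem modelPlus_A1 {M : ℕ} (hM : 1 ≤ M) :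
    modelPlus 0 (0, 1) M = {r | ∃ j : ℕ, 1 ≤ j ∧ j ≤ M + 1 ∧ r = 2 / 3 ^ j} := by
  ext r
  constructor
  · rintro ⟨u, hu, rfl⟩
    obtain ⟨j, hj, hjM, h1⟩ := hu.bound_A1 hM
    exact ⟨j, hj, hjM, by rw [h1, hu.1]; simp⟩
  · rintro ⟨j, hj, hjM, rfl⟩
    obtain ⟨u, hu, h1⟩ := exists_A1 hM hj hjM
    exact ⟨u, hu, by rw [h1, hu.1]; simp⟩

theorem modelPlusAdm_A1 {M : ℕ} (hM : 1 ≤ M) :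
    modelPlusAdm 0 (0, 1) M = {r | ∃ j : ℕ, 2 ≤ j ∧ j ≤ M ∧ r = 2 / 3 ^ j} := by
  ext r
  constructor
  · rintro ⟨u, ⟨hu, hc⟩, rfl⟩
    obtain ⟨j, hj, hjM, h1⟩ := hu.boundAdm_A1 hM hc
    exact ⟨j, hj, hjM, by rw [h1, hu.1]; simp⟩
  · rintro ⟨j, hj, hjM, rfl⟩
    obtain ⟨u, hu, h1⟩ := existsAdm_A1 hj hjM
    exact ⟨u, hu, by rw [h1, hu.1.1]; simp⟩

theorem modelPlus_A2 {M : ℕ} (hM : 1 ≤ M) :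
    modelPlus 1 (0, 1) M = {r | ∃ j : ℕ, 1 ≤ j ∧ j ≤ M ∧ r = 1 / 3 ^ j} := by
  ext r
  constructor
  · rintro ⟨u, hu, rfl⟩
    obtain ⟨j, hj, hjM, h1⟩ := hu.bound_A2 hM
    exact ⟨j, hj, hjM, by rw [h1, hu.1]; simp⟩
  · rintro ⟨j, hj, hjM, rfl⟩
    obtain ⟨u, hu, h1⟩ := existsAdm_A2 hj hjM
    exact ⟨u, hu.1, by rw [h1, hu.1.1]; simp⟩

theorem modelPlusAdm_A2 {M : ℕ} (hM : 1 ≤ M) :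
    modelPlusAdm 1 (0, 1) M = {r | ∃ j : ℕ, 1 ≤ j ∧ j ≤ M ∧ r = 1 / 3 ^ j} := by
  ext r
  constructor
  · rintro ⟨u, ⟨hu, -⟩, rfl⟩
    obtain ⟨j, hj, hjM, h1⟩ := hu.bound_A2 hM
    exact ⟨j, hj, hjM, by rw [h1, hu.1]; simp⟩
  · rintro ⟨j, hj, hjM, rfl⟩
    obtain ⟨u, hu, h1⟩ := existsAdm_A2 hj hjM
    exact ⟨u, hu, by rw [h1, hu.1.1]; simp⟩

theorem ratio_two_thirds (j : ℕ) : (2 / 3 ^ (j + 1) : ℝ) / (2 / 3) = 1 / 3 ^ j := by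
  field_simp; ring

theorem modelPlus_B {M : ℕ} (hM : 1 ≤ M) :
    modelPlus 0 (0, 2 / 3) M = {r | ∃ j : ℕ, 1 ≤ j ∧ j ≤ M ∧ r = 1 / 3 ^ j} := by
  ext r
  constructor
  · rintro ⟨u, hu, rfl⟩
    obtain ⟨j, hj, hjM, h1⟩ := hu.bound_B hM
    exact ⟨j, hj, hjM, by rw [h1, hu.1, sub_zero, sub_zero, ratio_two_thirds]⟩
  · rintro ⟨j, hj, hjM, rfl⟩
    obtain ⟨u, hu, h1⟩ := exists_B hj hjM
    exact ⟨u, hu, by rw [h1, hu.1, sub_zero, sub_zero, ratio_two_thirds]⟩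

theorem modelPlusAdm_B {M : ℕ} (hM : 1 ≤ M) :
    modelPlusAdm 0 (0, 2 / 3) M = {r | ∃ j : ℕ, 1 ≤ j ∧ j ≤ M - 1 ∧ r = 1 / 3 ^ j} := by
  ext r
  constructor
  · rintro ⟨u, ⟨hu, hc⟩, rfl⟩
    obtain ⟨j, hj, hjM, h1⟩ := hu.boundAdm_B hM hc
    exact ⟨j, hj, hjM, by rw [h1, hu.1, sub_zero, sub_zero, ratio_two_thirds]⟩
  · rintro ⟨j, hj, hjM, rfl⟩
    obtain ⟨u, hu, h1⟩ := existsAdm_B hj hjM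
    exact ⟨u, hu, by rw [h1, hu.1.1, sub_zero, sub_zero, ratio_two_thirds]⟩

theorem ratio_from_third (j : ℕ) :
    (1 / 3 + 2 / 3 ^ (j + 1) - 1 / 3 : ℝ) / (1 - 1 / 3) = 1 / 3 ^ j := by
  rw [add_sub_cancel_left, ← ratio_two_thirds]; norm_num

theorem modelPlus_C {M : ℕ} (hM : 2 ≤ M) :
    modelPlus 0 (1 / 3, 1) M =
      {(1 : ℝ) / 2} ∪ {r | ∃ j : ℕ, 1 ≤ j ∧ j ≤ M ∧ r = 1 / 3 ^ j} := by
  ext r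
  constructor
  · rintro ⟨u, hu, rfl⟩
    rcases hu.bound_C (by omega) with h1 | ⟨j, hj, hjM, h1⟩
    · exact Or.inl (by rw [h1, hu.1]; norm_num)
    · exact Or.inr ⟨j, hj, hjM, by rw [h1, hu.1, ratio_from_third]⟩
  · rintro (rfl | ⟨j, hj, hjM, rfl⟩)
    · obtain ⟨u, hu, h1⟩ := exists_C_half (M := M) (by omega)
      exact ⟨u, hu, by rw [h1, hu.1]; norm_num⟩
    · obtain ⟨u, hu, h1⟩ := exists_C hM hj hjM
      exact ⟨u, hu, by rw [h1, hu.1, ratio_from_third]⟩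

theorem modelPlusAdm_C {M : ℕ} (hM : 1 ≤ M) :
    modelPlusAdm 0 (1 / 3, 1) M = {r | ∃ j : ℕ, 2 ≤ j ∧ j ≤ M ∧ r = 1 / 3 ^ j} := by
  ext r
  constructor
  · rintro ⟨u, ⟨hu, hc⟩, rfl⟩
    obtain ⟨j, hj, hjM, h1⟩ := hu.boundAdm_C hM hc
    exact ⟨j, hj, hjM, by rw [h1, hu.1, ratio_from_third]⟩
  · rintro ⟨j, hj, hjM, rfl⟩
    obtain ⟨u, hu, h1⟩ := existsAdm_C hj hjM
    exact ⟨u, hu, by rw [h1, hu.1.1, ratio_from_third]⟩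

theorem reflType_full : reflType (0, 1) = (0, 1) := by norm_num [reflType]

theorem reflType_left : reflType (0, 2 / 3) = (1 / 3, 1) := by norm_num [reflType]

theorem reflType_right : reflType (1 / 3, 1) = (0, 2 / 3) := by norm_num [reflType]

theorem IsAltRInterval.blueT_right {a b : ℝ} (h : IsAltRInterval a b) (ha : RedT (tc a)) :
    BlueT (tc b) := by
  rcases h.2 with h | h
  exacts [h.2, absurd h.1 ha.not_blueT]

theorem IsAltRInterval.redT_right {a b : ℝ} (h : IsAltRInterval a b) (ha : BlueT (tc a)) :
    RedT (tc b) := by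
  rcases h.2 with h | h
  exacts [absurd ha h.1.not_blueT, h.2]

theorem IsAltRInterval.redT_left {a b : ℝ} (h : IsAltRInterval a b) (hb : BlueT (tc b)) :
    RedT (tc a) := by
  rcases h.2 with h | h
  exacts [h.1, absurd hb h.2.not_blueT]

theorem ratioSets_A1 {a b : ℝ} {M n : ℕ} (hM : 1 ≤ M) (h : RIntervalWith a b (0, 1) n)
    (ha : RedT (tc a)) (hb : BlueT (tc b)) :
    NPlus a b M = {r | ∃ j : ℕ, 1 ≤ j ∧ j ≤ M + 1 ∧ r = 2 / 3 ^ j} ∧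
      NMinus a b M = {r | ∃ j : ℕ, 1 ≤ j ∧ j ≤ M + 1 ∧ r = 2 / 3 ^ j} ∧
      NPlusAdm a b M = {r | ∃ j : ℕ, 2 ≤ j ∧ j ≤ M ∧ r = 2 / 3 ^ j} ∧
      NMinusAdm a b M = {r | ∃ j : ℕ, 2 ≤ j ∧ j ≤ M ∧ r = 2 / 3 ^ j} := by
  obtain ⟨hJ, hI⟩ := rIntervalWith_iff.1 h
  have hsa : CircleHue 0 a := (circleHue_even rfl).2 ha
  have hsb : CircleHue (0 + 1) b := (circleHue_odd rfl).2 hb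
  rw [nPlus_eq_modelPlus hJ hI hsa hsb, nMinus_eq_modelPlus hJ hI hsa hsb,
    nPlusAdm_eq_modelPlusAdm hJ hI hsa hsb, nMinusAdm_eq_modelPlusAdm hJ hI hsa hsb,
    reflType_full, modelPlus_A1 hM, modelPlusAdm_A1 hM]
  exact ⟨rfl, rfl, rfl, rfl⟩

theorem ratioSets_A2 {a b : ℝ} {M n : ℕ} (hM : 1 ≤ M) (h : RIntervalWith a b (0, 1) n)
    (ha : BlueT (tc a)) (hb : RedT (tc b)) :
    NPlus a b M = {r | ∃ j : ℕ, 1 ≤ j ∧ j ≤ M ∧ r = 1 / 3 ^ j} ∧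
      NMinus a b M = {r | ∃ j : ℕ, 1 ≤ j ∧ j ≤ M ∧ r = 1 / 3 ^ j} ∧
      NPlusAdm a b M = {r | ∃ j : ℕ, 1 ≤ j ∧ j ≤ M ∧ r = 1 / 3 ^ j} ∧
      NMinusAdm a b M = {r | ∃ j : ℕ, 1 ≤ j ∧ j ≤ M ∧ r = 1 / 3 ^ j} := by
  obtain ⟨hJ, hI⟩ := rIntervalWith_iff.1 h
  have hsa : CircleHue 1 a := (circleHue_odd rfl).2 ha
  have hsb : CircleHue (1 + 1) b := (circleHue_even rfl).2 hb
  rw [nPlus_eq_modelPlus hJ hI hsa hsb, nMinus_eq_modelPlus hJ hI hsa hsb,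
    nPlusAdm_eq_modelPlusAdm hJ hI hsa hsb, nMinusAdm_eq_modelPlusAdm hJ hI hsa hsb,
    reflType_full, modelPlus_A2 hM, modelPlusAdm_A2 hM]
  exact ⟨rfl, rfl, rfl, rfl⟩

theorem ratioSets_B {a b : ℝ} {M n : ℕ} (hM : 2 ≤ M) (hab : IsAltRInterval a b)
    (h : RIntervalWith a b (0, 2 / 3) n) :
    NPlus a b M = {r | ∃ j : ℕ, 1 ≤ j ∧ j ≤ M ∧ r = 1 / 3 ^ j} ∧
      NPlusAdm a b M = {r | ∃ j : ℕ, 1 ≤ j ∧ j ≤ M - 1 ∧ r = 1 / 3 ^ j} ∧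
      NMinus a b M = {(1 : ℝ) / 2} ∪ {r | ∃ j : ℕ, 1 ≤ j ∧ j ≤ M ∧ r = 1 / 3 ^ j} ∧
      NMinusAdm a b M = {r | ∃ j : ℕ, 2 ≤ j ∧ j ≤ M ∧ r = 1 / 3 ^ j} := by
  obtain ⟨hJ, hI⟩ := rIntervalWith_iff.1 h
  have hb : BlueT (tc b) := by
    obtain ⟨k, -, hb⟩ := hI
    exact blueT_tc_iff.2 (Or.inr ⟨3 * k + 2, n + 1, by omega, by omega, by
      rw [hb]; push_cast; field_simp; ring⟩)
  have hsa : CircleHue 0 a := (circleHue_even rfl).2 (hab.redT_left hb)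
  have hsb : CircleHue (0 + 1) b := (circleHue_odd rfl).2 hb
  rw [nPlus_eq_modelPlus hJ hI hsa hsb, nMinus_eq_modelPlus hJ hI hsa hsb,
    nPlusAdm_eq_modelPlusAdm hJ hI hsa hsb, nMinusAdm_eq_modelPlusAdm hJ hI hsa hsb,
    reflType_left, modelPlus_B (by omega), modelPlusAdm_B (by omega), modelPlus_C hM,
    modelPlusAdm_C (by omega)]
  exact ⟨rfl, rfl, rfl, rfl⟩

theorem ratioSets_C {a b : ℝ} {M n : ℕ} (hM : 2 ≤ M) (hab : IsAltRInterval a b)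
    (h : RIntervalWith a b (1 / 3, 1) n) :
    NPlus a b M = {(1 : ℝ) / 2} ∪ {r | ∃ j : ℕ, 1 ≤ j ∧ j ≤ M ∧ r = 1 / 3 ^ j} ∧
      NPlusAdm a b M = {r | ∃ j : ℕ, 2 ≤ j ∧ j ≤ M ∧ r = 1 / 3 ^ j} ∧
      NMinus a b M = {r | ∃ j : ℕ, 1 ≤ j ∧ j ≤ M ∧ r = 1 / 3 ^ j} ∧
      NMinusAdm a b M = {r | ∃ j : ℕ, 1 ≤ j ∧ j ≤ M - 1 ∧ r = 1 / 3 ^ j} := by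
  obtain ⟨hJ, hI⟩ := rIntervalWith_iff.1 h
  have ha : RedT (tc a) := by
    obtain ⟨k, ha, -⟩ := hI
    exact redT_tc_iff.2 ⟨3 * k + 1, n + 1, by omega, by omega, by
      rw [ha]; push_cast; field_simp; ring⟩
  have hsa : CircleHue 0 a := (circleHue_even rfl).2 ha
  have hsb : CircleHue (0 + 1) b := (circleHue_odd rfl).2 (hab.blueT_right ha)
  rw [nPlus_eq_modelPlus hJ hI hsa hsb, nMinus_eq_modelPlus hJ hI hsa hsb,
    nPlusAdm_eq_modelPlusAdm hJ hI hsa hsb, nMinusAdm_eq_modelPlusAdm hJ hI hsa hsb,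
    reflType_right, modelPlus_B (by omega), modelPlusAdm_B (by omega), modelPlus_C hM,
    modelPlusAdm_C (by omega)]
  exact ⟨rfl, rfl, rfl, rfl⟩

theorem exists_admissible_of_nPlusAdm {a b r : ℝ} {M : ℕ} {S : Set ℝ} (h : NPlusAdm a b M = S)
    (hr : r ∈ S) : ∃ x : ℕ → ℝ, AdmissibleAltDecomp a b M x := by
  rw [← h] at hr
  obtain ⟨x, hx, -⟩ := hr
  exact ⟨x, hx⟩

/-- The computation of the sets `𝒩^±(I,M)` and `𝒩^±ₒ(I,M)` for an alternating R-interval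
`I` and `M ≥ 2`, according to the subtype (A1, A2, B or C) of `I`; in particular, every
alternating R-interval admits an admissible alternating decomposition into `2M+1` pieces. -/
theorem rInterval_ratio_sets (a b : ℝ) (M : ℕ) (hM : 2 ≤ M)
    (hI : IsAltRInterval a b) :
    (((∃ n, RIntervalWith a b (0, 1) n) ∧ RedT (tc a)) →
      NPlus a b M = {r | ∃ j : ℕ, 1 ≤ j ∧ j ≤ M + 1 ∧ r = 2 / 3 ^ j} ∧
      NMinus a b M = {r | ∃ j : ℕ, 1 ≤ j ∧ j ≤ M + 1 ∧ r = 2 / 3 ^ j} ∧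
      NPlusAdm a b M = {r | ∃ j : ℕ, 2 ≤ j ∧ j ≤ M ∧ r = 2 / 3 ^ j} ∧
      NMinusAdm a b M = {r | ∃ j : ℕ, 2 ≤ j ∧ j ≤ M ∧ r = 2 / 3 ^ j}) ∧
    (((∃ n, RIntervalWith a b (0, 1) n) ∧ BlueT (tc a)) →
      NPlus a b M = {r | ∃ j : ℕ, 1 ≤ j ∧ j ≤ M ∧ r = 1 / 3 ^ j} ∧
      NMinus a b M = {r | ∃ j : ℕ, 1 ≤ j ∧ j ≤ M ∧ r = 1 / 3 ^ j} ∧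
      NPlusAdm a b M = {r | ∃ j : ℕ, 1 ≤ j ∧ j ≤ M ∧ r = 1 / 3 ^ j} ∧
      NMinusAdm a b M = {r | ∃ j : ℕ, 1 ≤ j ∧ j ≤ M ∧ r = 1 / 3 ^ j}) ∧
    ((∃ n, RIntervalWith a b (0, 2/3) n) →
      NPlus a b M = {r | ∃ j : ℕ, 1 ≤ j ∧ j ≤ M ∧ r = 1 / 3 ^ j} ∧
      NPlusAdm a b M = {r | ∃ j : ℕ, 1 ≤ j ∧ j ≤ M - 1 ∧ r = 1 / 3 ^ j} ∧
      NMinus a b M = {(1 : ℝ) / 2} ∪ {r | ∃ j : ℕ, 1 ≤ j ∧ j ≤ M ∧ r = 1 / 3 ^ j} ∧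
      NMinusAdm a b M = {r | ∃ j : ℕ, 2 ≤ j ∧ j ≤ M ∧ r = 1 / 3 ^ j}) ∧
    ((∃ n, RIntervalWith a b (1/3, 1) n) →
      NPlus a b M = {(1 : ℝ) / 2} ∪ {r | ∃ j : ℕ, 1 ≤ j ∧ j ≤ M ∧ r = 1 / 3 ^ j} ∧
      NPlusAdm a b M = {r | ∃ j : ℕ, 2 ≤ j ∧ j ≤ M ∧ r = 1 / 3 ^ j} ∧
      NMinus a b M = {r | ∃ j : ℕ, 1 ≤ j ∧ j ≤ M ∧ r = 1 / 3 ^ j} ∧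
      NMinusAdm a b M = {r | ∃ j : ℕ, 1 ≤ j ∧ j ≤ M - 1 ∧ r = 1 / 3 ^ j}) ∧
    (∃ x : ℕ → ℝ, AdmissibleAltDecomp a b M x) := by
  have hM1 : 1 ≤ M := by omega
  refine ⟨fun ⟨⟨n, h⟩, ha⟩ => ratioSets_A1 hM1 h ha (hI.blueT_right ha),
    fun ⟨⟨n, h⟩, ha⟩ => ratioSets_A2 hM1 h ha (hI.redT_right ha),
    fun ⟨n, h⟩ => ratioSets_B hM hI h, fun ⟨n, h⟩ => ratioSets_C hM hI h, ?_⟩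
  obtain ⟨J, n, h⟩ := hI.1
  rcases (rIntervalWith_iff.1 h).1 with rfl | rfl | rfl
  · rcases hI.2 with ⟨ha, hb⟩ | ⟨ha, hb⟩
    · exact exists_admissible_of_nPlusAdm (ratioSets_A1 hM1 h ha hb).2.2.1 ⟨2, le_rfl, hM, rfl⟩
    · exact exists_admissible_of_nPlusAdm (ratioSets_A2 hM1 h ha hb).2.2.1 ⟨1, le_rfl, hM1, rfl⟩
  · exact exists_admissible_of_nPlusAdm (ratioSets_B hM hI h).2.1 ⟨1, le_rfl, by omega, rfl⟩
  · exact exists_admissible_of_nPlusAdm (ratioSets_C hM hI h).2.1 ⟨2, le_rfl, hM, rfl⟩
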